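/- arXiv:math/0607813 — 3 statements merged into one kernel-verified Lean document; each statement's English description precedes it below -/
import Mathlib

section
/- Let V = { f = (f_k)_{k≥0} real : Σ_{k≥0}(1+k)^{3/2} f_k² < ∞ and Σ_{k≥0} f_k = 0 } (the last series converges absolutely). For f ∈ V define (𝒜f)_n = (2/π) Σ_{k≥0} f_k/(2(n−k)+1) for n ≥ 0 (the series converges absolutely). Then 𝒜 is a linear bijection from V onto ℓ²_{3/4}, and there exist absolute constants C₁, C₂ > 0 with C₁‖f‖_{ℓ²_{3/4}} ≤ ‖𝒜f‖_{ℓ²_{3/4}} ≤ C₂‖f‖_{ℓ²_{3/4}} for all f ∈ V. -/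
open scoped BigOperators

/-- Membership in the weighted space `ℓ²_r`: `Σ (1+n)^{2r} c_n² < ∞`. -/
def MemL2r (r : ℝ) (c : ℕ → ℝ) : Prop :=
  Summable (fun n : ℕ => (1 + (n : ℝ)) ^ (2 * r) * (c n) ^ 2)

/-- The `ℓ²_r`-norm `(Σ (1+n)^{2r} c_n²)^{1/2}`. -/
noncomputable def normL2r (r : ℝ) (c : ℕ → ℝ) : ℝ :=
  (∑' n : ℕ, (1 + (n : ℝ)) ^ (2 * r) * (c n) ^ 2) ^ ((1 : ℝ) / 2)

/-- The space `V = {f : Σ (1+k)^{3/2} f_k² < ∞, Σ f_k = 0 (absolutely convergent)}`. -/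
def MemV (f : ℕ → ℝ) : Prop :=
  MemL2r (3 / 4) f ∧ Summable (fun k : ℕ => |f k|) ∧ (∑' k : ℕ, f k) = 0

/-- The operator `(𝒜 f)_n = (2/π) Σ_{k≥0} f_k / (2(n-k)+1)`. -/
noncomputable def Aop (f : ℕ → ℝ) (n : ℕ) : ℝ :=
  (2 / Real.pi) * ∑' k : ℕ, f k / (2 * ((n : ℝ) - (k : ℝ)) + 1)

open Filter Topology

/-- The normalised central binomial coefficients, i.e. the Taylor coefficients of `(1 - z)^(-1/2)`. -/
noncomputable def invSqrtCoeff (n : ℕ) : ℝ := (Nat.centralBinom n : ℝ) / 4 ^ n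

lemma invSqrtCoeff_zero : invSqrtCoeff 0 = 1 := by simp [invSqrtCoeff]

lemma invSqrtCoeff_pos (n : ℕ) : 0 < invSqrtCoeff n := by
  have := Nat.centralBinom_pos n
  unfold invSqrtCoeff
  positivity

lemma invSqrtCoeff_succ (n : ℕ) :
    (2 * (n : ℝ) + 2) * invSqrtCoeff (n + 1) = (2 * n + 1) * invSqrtCoeff n := by
  have h : ((n : ℝ) + 1) * (Nat.centralBinom (n + 1) : ℝ)
      = 2 * (2 * n + 1) * (Nat.centralBinom n : ℝ) := by
    exact_mod_cast Nat.succ_mul_centralBinom_succ n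
  unfold invSqrtCoeff
  rw [pow_succ]
  field_simp
  linarith

lemma invSqrtCoeff_succ_eq (n : ℕ) :
    invSqrtCoeff (n + 1) = (2 * n + 1) / (2 * n + 2) * invSqrtCoeff n := by
  have := invSqrtCoeff_succ n
  field_simp
  linarith

lemma sq_invSqrtCoeff_le (n : ℕ) : invSqrtCoeff n ^ 2 * (n + 1) ≤ 1 := by
  induction n with
  | zero => simp [invSqrtCoeff_zero]
  | succ n ih =>
    refine le_trans ?_ ih
    rw [invSqrtCoeff_succ_eq]
    have hb : 0 ≤ invSqrtCoeff n ^ 2 := sq_nonneg _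
    have key : ((2 * (n : ℝ) + 1) / (2 * n + 2)) ^ 2 * (n + 2) ≤ n + 1 := by
      rw [div_pow, div_mul_eq_mul_div, div_le_iff₀ (by positivity)]
      nlinarith [(Nat.cast_nonneg n : (0 : ℝ) ≤ n)]
    push_cast
    nlinarith [mul_le_mul_of_nonneg_left key hb]

lemma le_sq_invSqrtCoeff (n : ℕ) : 1 ≤ invSqrtCoeff n ^ 2 * (4 * n + 1) := by
  induction n with
  | zero => simp [invSqrtCoeff_zero]
  | succ n ih =>
    refine ih.trans ?_
    rw [invSqrtCoeff_succ_eq]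
    have hb : 0 ≤ invSqrtCoeff n ^ 2 := sq_nonneg _
    have key : 4 * (n : ℝ) + 1 ≤ ((2 * (n : ℝ) + 1) / (2 * n + 2)) ^ 2 * (4 * n + 5) := by
      rw [div_pow, div_mul_eq_mul_div, le_div_iff₀ (by positivity)]
      nlinarith [(Nat.cast_nonneg n : (0 : ℝ) ≤ n)]
    push_cast
    nlinarith [mul_le_mul_of_nonneg_left key hb]

lemma invSqrtCoeff_mul_sqrt_le (n : ℕ) : invSqrtCoeff n * √((n : ℝ) + 1) ≤ 1 := by
  have h := sq_invSqrtCoeff_le n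
  have hs := Real.sq_sqrt (show (0 : ℝ) ≤ (n : ℝ) + 1 by positivity)
  refine (sq_le_one_iff₀ (mul_nonneg (invSqrtCoeff_pos n).le (Real.sqrt_nonneg _))).1 ?_
  rw [mul_pow, hs]
  exact h

lemma le_invSqrtCoeff_mul_sqrt (n : ℕ) : 1 ≤ 2 * (invSqrtCoeff n * √((n : ℝ) + 1)) := by
  have h := le_sq_invSqrtCoeff n
  have hs := Real.sq_sqrt (show (0 : ℝ) ≤ (n : ℝ) + 1 by positivity)
  have hp : 0 ≤ 2 * (invSqrtCoeff n * √((n : ℝ) + 1)) :=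
    mul_nonneg zero_le_two (mul_nonneg (invSqrtCoeff_pos n).le (Real.sqrt_nonneg _))
  refine (one_le_sq_iff₀ hp).1 ?_
  rw [mul_pow, mul_pow, hs]
  nlinarith [sq_nonneg (invSqrtCoeff n)]

lemma tendsto_invSqrtCoeff : Tendsto invSqrtCoeff atTop (𝓝 0) := by
  have h : Tendsto (fun n : ℕ => 1 / √((n : ℝ) + 1)) atTop (𝓝 0) := by
    simp only [one_div]
    exact (Real.tendsto_sqrt_atTop.comp
      (tendsto_atTop_add_const_right _ _ tendsto_natCast_atTop_atTop)).inv_tendsto_atTop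
  refine squeeze_zero (fun n => (invSqrtCoeff_pos n).le) (fun n => ?_) h
  rw [le_div_iff₀ (by positivity)]
  exact invSqrtCoeff_mul_sqrt_le n

lemma one_le_abs_odd (n m : ℕ) : 1 ≤ |2 * (n : ℝ) + 1 - 2 * m| := by
  have h : (1 : ℤ) ≤ |2 * (n : ℤ) + 1 - 2 * m| := Int.one_le_abs (by omega)
  exact_mod_cast h

lemma odd_ne_zero (n m : ℕ) : 2 * (n : ℝ) + 1 - 2 * m ≠ 0 := by
  intro h
  have := one_le_abs_odd n m
  rw [h, abs_zero] at this
  linarith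

lemma odd_le_mul_abs (n m : ℕ) :
    2 * (n : ℝ) + 1 ≤ (2 * m + 1) * |2 * (n : ℝ) + 1 - 2 * m| := by
  have h1 := one_le_abs_odd n m
  have h2 := le_abs_self (2 * (n : ℝ) + 1 - 2 * m)
  nlinarith [(Nat.cast_nonneg m : (0 : ℝ) ≤ m)]

lemma summable_invSqrtCoeff_div_odd :
    Summable (fun n : ℕ => invSqrtCoeff n / (2 * (n : ℝ) + 1)) := by
  refine summable_of_sum_range_le (c := 2) (fun n => ?_) (fun n => ?_)
  · have := invSqrtCoeff_pos n
    positivity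
  · calc ∑ i ∈ Finset.range n, invSqrtCoeff i / (2 * (i : ℝ) + 1)
        ≤ ∑ i ∈ Finset.range n, 2 * (invSqrtCoeff i - invSqrtCoeff (i + 1)) := by
          refine Finset.sum_le_sum fun i _ => ?_
          have := invSqrtCoeff_pos i
          rw [invSqrtCoeff_succ_eq, div_le_iff₀ (by positivity)]
          have e : 2 * (invSqrtCoeff i - (2 * (i : ℝ) + 1) / (2 * i + 2) * invSqrtCoeff i)
              * (2 * i + 1) = invSqrtCoeff i * ((2 * i + 1) / (i + 1)) := by
            field_simp
            ring
          rw [e]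
          refine le_mul_of_one_le_right this.le ?_
          rw [one_le_div (by positivity)]
          linarith [(Nat.cast_nonneg i : (0 : ℝ) ≤ i)]
      _ = 2 * (invSqrtCoeff 0 - invSqrtCoeff n) := by
          rw [← Finset.mul_sum, Finset.sum_range_sub']
      _ ≤ 2 := by
          rw [invSqrtCoeff_zero]
          linarith [invSqrtCoeff_pos n]

lemma summable_invSqrtCoeff_div (m : ℕ) :
    Summable (fun n : ℕ => invSqrtCoeff n / (2 * (n : ℝ) + 1 - 2 * m)) := by
  refine Summable.of_norm_bounded (summable_invSqrtCoeff_div_odd.mul_left (2 * (m : ℝ) + 1))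
    fun n => ?_
  have h := odd_le_mul_abs n m
  have hb := invSqrtCoeff_pos n
  have h1 := one_le_abs_odd n m
  rw [norm_div, Real.norm_eq_abs, Real.norm_eq_abs, abs_of_pos hb, mul_div_assoc',
    div_le_div_iff₀ (by linarith) (by positivity)]
  nlinarith

lemma summable_invSqrtCoeff_div_sq (m : ℕ) :
    Summable (fun n : ℕ => invSqrtCoeff n / (2 * (n : ℝ) + 1 - 2 * m) ^ 2) := by
  refine Summable.of_norm_bounded (summable_invSqrtCoeff_div m).norm fun n => ?_
  have h1 := one_le_abs_odd n m
  have hb := invSqrtCoeff_pos n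
  rw [norm_div, norm_div, norm_pow, Real.norm_eq_abs, Real.norm_eq_abs, abs_of_pos hb]
  refine div_le_div_of_nonneg_left hb.le (by linarith) ?_
  nlinarith

/-- The sum of the series `Σ β_n / (2 n + 1)`, whose value is `π / 2`. -/
noncomputable def arcsinOne : ℝ := ∑' n : ℕ, invSqrtCoeff n / (2 * (n : ℝ) + 1)

lemma arcsinOne_pos : 0 < arcsinOne := by
  refine summable_invSqrtCoeff_div_odd.tsum_pos (fun n => ?_) 0 ?_
  · have := invSqrtCoeff_pos n
    positivity
  · simp [invSqrtCoeff_zero]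

lemma hasSum_zero_of_telescoping {g c : ℕ → ℝ} (hg : Summable g)
    (h : ∀ n, g n = c (n + 1) - c n) (h0 : c 0 = 0) (hc : Tendsto c atTop (𝓝 0)) :
    HasSum g 0 := by
  have h1 := hg.hasSum.tendsto_sum_nat
  simp only [h, Finset.sum_range_sub, h0, sub_zero] at h1
  have h2 := tendsto_nhds_unique h1 hc
  have h3 := hg.hasSum
  simp only [h] at h3 ⊢
  rwa [h2] at h3

lemma tendsto_telescope (m : ℕ) :
    Tendsto (fun n : ℕ => 2 * (n : ℝ) * invSqrtCoeff n / (2 * (n : ℝ) + 1 - 2 * m))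
      atTop (𝓝 0) := by
  refine squeeze_zero_norm (a := fun n => (2 * (m : ℝ) + 1) * invSqrtCoeff n) (fun n => ?_) ?_
  · have h1 := one_le_abs_odd n m
    have h := odd_le_mul_abs n m
    have hb := invSqrtCoeff_pos n
    rw [norm_div, Real.norm_eq_abs, Real.norm_eq_abs, abs_of_nonneg (by positivity),
      div_le_iff₀ (by linarith)]
    nlinarith
  · simpa using tendsto_invSqrtCoeff.const_mul (2 * (m : ℝ) + 1)

lemma tendsto_telescope_sq (m : ℕ) :
    Tendsto (fun n : ℕ => 2 * (n : ℝ) * invSqrtCoeff n / (2 * (n : ℝ) + 1 - 2 * m) ^ 2)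
      atTop (𝓝 0) := by
  refine squeeze_zero_norm (fun n => ?_) (tendsto_zero_iff_norm_tendsto_zero.1 (tendsto_telescope m))
  have h1 := one_le_abs_odd n m
  rw [norm_div, norm_div, norm_pow]
  simp only [Real.norm_eq_abs] at *
  refine div_le_div_of_nonneg_left (abs_nonneg _) (by linarith) ?_
  nlinarith

lemma hasSum_invSqrtCoeff_div (m : ℕ) :
    HasSum (fun n : ℕ => invSqrtCoeff n / (2 * (n : ℝ) + 1 - 2 * m))
      (if m = 0 then arcsinOne else 0) := by
  induction m with
  | zero => simpa [arcsinOne] using summable_invSqrtCoeff_div_odd.hasSum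
  | succ m ih =>
    have hs := summable_invSqrtCoeff_div (m + 1)
    have ht : HasSum (fun n : ℕ => 2 * (m : ℝ) * (invSqrtCoeff n / (2 * (n : ℝ) + 1 - 2 * m))
        - (2 * (m : ℝ) + 1) * (invSqrtCoeff n / (2 * (n : ℝ) + 1 - 2 * (m + 1 : ℕ)))) 0 := by
      refine hasSum_zero_of_telescoping
        ((ih.summable.mul_left _).sub (hs.mul_left _)) (fun n => ?_) ?_ (tendsto_telescope (m + 1))
      · have e1 := odd_ne_zero n m
        have e2 := odd_ne_zero n (m + 1)
        have e3 := odd_ne_zero (n + 1) (m + 1)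
        have e : 2 * ((n + 1 : ℕ) : ℝ) + 1 - 2 * (m + 1 : ℕ) = 2 * (n : ℝ) + 1 - 2 * m := by
          push_cast; ring
        have hb := invSqrtCoeff_succ n
        have e4 : 2 * ((n + 1 : ℕ) : ℝ) * invSqrtCoeff (n + 1) = (2 * n + 1) * invSqrtCoeff n := by
          rw [← hb]; push_cast; ring
        rw [e, e4]
        field_simp
        push_cast
        ring
      · simp
    have h2 := ((ih.mul_left (2 * (m : ℝ))).sub (hs.hasSum.mul_left (2 * (m : ℝ) + 1))).unique ht
    have h3 : 2 * (m : ℝ) * (if m = 0 then arcsinOne else 0) = 0 := by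
      split_ifs with h <;> simp [h]
    rw [h3, zero_sub, neg_eq_zero] at h2
    have h4 := (mul_eq_zero.1 h2).resolve_left (by positivity)
    have := hs.hasSum
    rw [h4] at this
    simpa using this

lemma hasSum_invSqrtCoeff_div_sq (m : ℕ) :
    HasSum (fun n : ℕ => invSqrtCoeff n / (2 * (n : ℝ) + 1 - 2 * (m + 1 : ℕ)) ^ 2)
      (arcsinOne / ((2 * m + 1) * invSqrtCoeff m)) := by
  have hs0 := summable_invSqrtCoeff_div_sq
  have ht (m : ℕ) : HasSum (fun n : ℕ => (invSqrtCoeff n / (2 * (n : ℝ) + 1 - 2 * m)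
        + 2 * (m : ℝ) * (invSqrtCoeff n / (2 * (n : ℝ) + 1 - 2 * m) ^ 2))
        - (invSqrtCoeff n / (2 * (n : ℝ) + 1 - 2 * (m + 1 : ℕ))
        + (2 * (m : ℝ) + 1) * (invSqrtCoeff n / (2 * (n : ℝ) + 1 - 2 * (m + 1 : ℕ)) ^ 2))) 0 := by
    refine hasSum_zero_of_telescoping
      (((summable_invSqrtCoeff_div m).add ((hs0 m).mul_left _)).sub
        ((summable_invSqrtCoeff_div (m + 1)).add ((hs0 (m + 1)).mul_left _))) (fun n => ?_) ?_
        (tendsto_telescope_sq (m + 1))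
    · have e1 := odd_ne_zero n m
      have e2 := odd_ne_zero n (m + 1)
      have e : 2 * ((n + 1 : ℕ) : ℝ) + 1 - 2 * (m + 1 : ℕ) = 2 * (n : ℝ) + 1 - 2 * m := by
        push_cast; ring
      have hb := invSqrtCoeff_succ n
      have e4 : 2 * ((n + 1 : ℕ) : ℝ) * invSqrtCoeff (n + 1) = (2 * n + 1) * invSqrtCoeff n := by
        rw [← hb]; push_cast; ring
      rw [e, e4]
      field_simp
      push_cast
      ring
    · simp
  have hrec (m : ℕ) := (((hasSum_invSqrtCoeff_div m).add ((hs0 m).hasSum.mul_left _)).sub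
    ((hasSum_invSqrtCoeff_div (m + 1)).add ((hs0 (m + 1)).hasSum.mul_left _))).unique (ht m)
  suffices h : ∑' n : ℕ, invSqrtCoeff n / (2 * (n : ℝ) + 1 - 2 * (m + 1 : ℕ)) ^ 2
      = arcsinOne / ((2 * m + 1) * invSqrtCoeff m) by
    rw [← h]
    exact (hs0 (m + 1)).hasSum
  induction m with
  | zero =>
    have h := hrec 0
    simp only [Nat.cast_zero, invSqrtCoeff_zero] at h ⊢
    simp only [if_true, mul_zero, zero_mul, add_zero, zero_add, one_mul, one_ne_zero,
      if_false] at h ⊢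
    simp only [div_one]
    linarith
  | succ m ih =>
    have h := hrec (m + 1)
    rw [ih] at h
    have hb := invSqrtCoeff_pos m
    simp only [Nat.add_eq_zero_iff, one_ne_zero, and_false, if_false, zero_add] at h
    have h5 : (2 * ((m + 1 : ℕ) : ℝ) + 1) ≠ 0 := by positivity
    rw [sub_eq_zero, eq_comm] at h
    rw [eq_div_of_mul_eq h5 ((mul_comm _ _).trans h), invSqrtCoeff_succ_eq]
    push_cast
    field_simp

section OrthogonalMatrix

variable {m : ℕ → ℕ → ℝ}

lemma memℓp_two_iff_summable_sq {x : ℕ → ℝ} :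
    Memℓp x 2 ↔ Summable (fun n => x n ^ 2) := by
  rw [memℓp_gen_iff (by norm_num)]
  simp

lemma lp_two_norm_sq (x : lp (fun _ : ℕ => ℝ) 2) : ‖x‖ ^ 2 = ∑' n, x n ^ 2 := by
  have h := lp.norm_rpow_eq_tsum (p := 2) (by norm_num) x
  simpa using h

/-- A real matrix with orthonormal rows acts (by transposition) as a linear isometry of `ℓ²`. -/
lemma exists_linearIsometry_of_orthonormal_rows
    (hr : ∀ p q, HasSum (fun n => m p n * m q n) (if p = q then 1 else 0)) :
    ∃ L : lp (fun _ : ℕ => ℝ) 2 →ₗᵢ[ℝ] lp (fun _ : ℕ => ℝ) 2,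
      ∀ y n, HasSum (fun p => m p n * y p) (L y n) := by
  have hmem (p : ℕ) : Memℓp (m p) 2 := by
    rw [memℓp_two_iff_summable_sq]
    simpa [sq] using (hr p p).summable
  let r (p : ℕ) : lp (fun _ : ℕ => ℝ) 2 := ⟨m p, hmem p⟩
  have ho : Orthonormal ℝ r := by
    rw [orthonormal_iff_ite]
    intro p q
    refine (lp.hasSum_inner (𝕜 := ℝ) (r p) (r q)).unique ?_
    simpa [r, mul_comm] using hr p q
  refine ⟨ho.orthogonalFamily.linearIsometry, fun y n => ?_⟩
  have h := (ho.orthogonalFamily.hasSum_linearIsometry y).mapL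
    (lp.evalCLM ℝ (fun _ : ℕ => ℝ) 2 n)
  have e : (fun p => m p n * y p) = fun p => (lp.evalCLM ℝ (fun _ : ℕ => ℝ) 2 n)
      ((LinearIsometry.toSpanSingleton ℝ _ (ho.1 p)) (y p)) := by
    funext p
    simp [r, lp.evalCLM, mul_comm]
  rw [e]
  exact h

lemma sum_sq_of_orthonormal_rows
    (hr : ∀ p q, HasSum (fun n => m p n * m q n) (if p = q then 1 else 0))
    {y : ℕ → ℝ} (hy : Summable (fun p => y p ^ 2)) :
    HasSum (fun n => (∑' p, m p n * y p) ^ 2) (∑' p, y p ^ 2) := by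
  obtain ⟨L, hL⟩ := exists_linearIsometry_of_orthonormal_rows hr
  let z : lp (fun _ : ℕ => ℝ) 2 := ⟨y, memℓp_two_iff_summable_sq.2 hy⟩
  have h1 : ∀ n, ∑' p, m p n * y p = L z n := fun n => (hL z n).tsum_eq
  simp only [h1]
  have h2 : ∑' p, y p ^ 2 = ∑' n, L z n ^ 2 := by
    rw [← lp_two_norm_sq, L.norm_map, lp_two_norm_sq]
  rw [h2]
  exact (memℓp_two_iff_summable_sq.1 (lp.memℓp (L z))).hasSum

lemma exists_preimage_of_orthonormal
    (hr : ∀ p q, HasSum (fun n => m p n * m q n) (if p = q then 1 else 0))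
    (hc : ∀ n k, HasSum (fun p => m p n * m p k) (if n = k then 1 else 0))
    {x : ℕ → ℝ} (hx : Summable (fun n => x n ^ 2)) :
    ∃ y : ℕ → ℝ, Summable (fun p => y p ^ 2) ∧ ∀ n, ∑' p, m p n * y p = x n := by
  obtain ⟨L, hL⟩ := exists_linearIsometry_of_orthonormal_rows hr
  have hcl : IsClosed (LinearMap.range L.toLinearMap : Set (lp (fun _ : ℕ => ℝ) 2)) := by
    have := L.isometry.isClosedEmbedding.isClosed_range
    simpa [LinearMap.coe_range] using this
  have hsingle (k : ℕ) (a : ℝ) : lp.single 2 k a ∈ LinearMap.range L.toLinearMap := by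
    have hsum : Summable (fun p => (a * m p k) ^ 2) :=
      ((hc k k).summable.mul_left (a ^ 2)).congr fun p => by ring
    have hmem : Memℓp (fun p => a * m p k) 2 := memℓp_two_iff_summable_sq.2 hsum
    let z : lp (fun _ : ℕ => ℝ) 2 := ⟨fun p => a * m p k, hmem⟩
    have hz (n : ℕ) : L z n = if n = k then a else 0 := by
      have h := (hc n k).mul_left a
      simp only [mul_ite, mul_one, mul_zero] at h
      have e : (fun p => m p n * z p) = fun p => a * (m p n * m p k) := by
        funext p
        exact mul_left_comm _ _ _
      have h' := hL z n
      rw [e] at h'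
      exact h'.unique h
    refine ⟨z, lp.ext (funext fun n => ?_)⟩
    rw [lp.single_apply, Pi.single_apply]
    exact hz n
  have htop (z : lp (fun _ : ℕ => ℝ) 2) : z ∈ LinearMap.range L.toLinearMap := by
    refine hcl.mem_of_tendsto (lp.hasSum_single (by norm_num) z) (Eventually.of_forall fun s => ?_)
    exact Submodule.sum_mem _ fun k _ => hsingle k _
  obtain ⟨w, hw⟩ := htop ⟨x, memℓp_two_iff_summable_sq.2 hx⟩
  refine ⟨w, memℓp_two_iff_summable_sq.1 (lp.memℓp w), fun n => ?_⟩
  have h := (hL w n).tsum_eq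
  rw [h]
  exact congrArg (fun v : lp (fun _ : ℕ => ℝ) 2 => v n) hw

end OrthogonalMatrix

/-- The normalised weighted Hilbert matrix; it turns out to be orthogonal. -/
noncomputable def orthoHilbert (p n : ℕ) : ℝ :=
  √((2 * (p : ℝ) + 1) * invSqrtCoeff p) * √(invSqrtCoeff n) /
    (√arcsinOne * (2 * (p : ℝ) + 1 - 2 * n))

lemma HasSum.of_eq_of_eq {f g : ℕ → ℝ} {a b : ℝ} (h : HasSum f a) (hfg : ∀ n, f n = g n)
    (hab : a = b) : HasSum g b := by
  rwa [← funext hfg, ← hab]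

lemma orthoHilbert_rows (p q : ℕ) :
    HasSum (fun n => orthoHilbert p n * orthoHilbert q n) (if p = q then 1 else 0) := by
  have hs := arcsinOne_pos
  have hss : √arcsinOne * √arcsinOne = arcsinOne := Real.mul_self_sqrt hs.le
  have e : (fun n => orthoHilbert p n * orthoHilbert q n) = fun n : ℕ =>
      √((2 * (p : ℝ) + 1) * invSqrtCoeff p) * √((2 * (q : ℝ) + 1) * invSqrtCoeff q) / arcsinOne *
      (invSqrtCoeff n / ((2 * (n : ℝ) + 1 - 2 * (p + 1 : ℕ)) *
        (2 * (n : ℝ) + 1 - 2 * (q + 1 : ℕ)))) := by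
    funext n
    have h : √(invSqrtCoeff n) * √(invSqrtCoeff n) = invSqrtCoeff n :=
      Real.mul_self_sqrt (invSqrtCoeff_pos n).le
    have e1 : 2 * (n : ℝ) + 1 - 2 * (p + 1 : ℕ) = -(2 * (p : ℝ) + 1 - 2 * n) := by push_cast; ring
    have e2 : 2 * (n : ℝ) + 1 - 2 * (q + 1 : ℕ) = -(2 * (q : ℝ) + 1 - 2 * n) := by push_cast; ring
    rw [e1, e2, neg_mul_neg, div_mul_div_comm, orthoHilbert, orthoHilbert, div_mul_div_comm,
      mul_mul_mul_comm, h, mul_mul_mul_comm, hss]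
  rw [e]
  by_cases hpq : p = q
  · subst hpq
    have hb := invSqrtCoeff_pos p
    have h0 : 0 < (2 * (p : ℝ) + 1) * invSqrtCoeff p := by positivity
    rw [if_pos rfl, Real.mul_self_sqrt h0.le]
    refine ((hasSum_invSqrtCoeff_div_sq p).mul_left
      ((2 * (p : ℝ) + 1) * invSqrtCoeff p / arcsinOne)).of_eq_of_eq (fun n => ?_) ?_
    · simp only [sq]
    · field_simp
  · rw [if_neg hpq]
    have hne : ((q : ℝ) - p) ≠ 0 := sub_ne_zero.2 (by exact_mod_cast Ne.symm hpq)
    have h1 := (hasSum_invSqrtCoeff_div (q + 1)).sub (hasSum_invSqrtCoeff_div (p + 1))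
    simp only [Nat.add_eq_zero_iff, one_ne_zero, and_false, if_false, sub_zero] at h1
    have h2 := (h1.mul_left (1 / (2 * ((q : ℝ) - p)))).mul_left
      (√((2 * (p : ℝ) + 1) * invSqrtCoeff p) * √((2 * (q : ℝ) + 1) * invSqrtCoeff q) / arcsinOne)
    rw [mul_zero, mul_zero] at h2
    refine h2.congr_fun fun n => ?_
    have e1 := odd_ne_zero n (p + 1)
    have e2 := odd_ne_zero n (q + 1)
    congr 1
    rw [div_sub_div _ _ e2 e1, div_mul_div_comm, div_eq_div_iff (by positivity) (by positivity)]
    push_cast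
    ring

lemma orthoHilbert_columns (n k : ℕ) :
    HasSum (fun p => orthoHilbert p n * orthoHilbert p k) (if n = k then 1 else 0) := by
  have hs := arcsinOne_pos
  have hss : √arcsinOne * √arcsinOne = arcsinOne := Real.mul_self_sqrt hs.le
  have e : (fun p => orthoHilbert p n * orthoHilbert p k) = fun p : ℕ =>
      √(invSqrtCoeff n) * √(invSqrtCoeff k) / arcsinOne *
      ((2 * (p : ℝ) + 1) * invSqrtCoeff p / ((2 * (p : ℝ) + 1 - 2 * n) *
        (2 * (p : ℝ) + 1 - 2 * k))) := by
    funext p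
    have h : √((2 * (p : ℝ) + 1) * invSqrtCoeff p) * √((2 * (p : ℝ) + 1) * invSqrtCoeff p)
        = (2 * (p : ℝ) + 1) * invSqrtCoeff p :=
      Real.mul_self_sqrt (mul_nonneg (by positivity) (invSqrtCoeff_pos p).le)
    rw [div_mul_div_comm, orthoHilbert, orthoHilbert, div_mul_div_comm,
      mul_mul_mul_comm, h, mul_mul_mul_comm (√arcsinOne), hss,
      mul_comm (√(invSqrtCoeff n) * _)]
  rw [e]
  have hz (j : ℕ) : HasSum (fun p : ℕ => (j : ℝ) * (invSqrtCoeff p / (2 * (p : ℝ) + 1 - 2 * j)))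
      0 := by
    refine ((hasSum_invSqrtCoeff_div j).mul_left (j : ℝ)).of_eq_of_eq (fun _ => rfl) ?_
    split_ifs with h <;> simp [h]
  by_cases hnk : n = k
  · subst hnk
    rw [if_pos rfl, Real.mul_self_sqrt (invSqrtCoeff_pos n).le]
    have hb := invSqrtCoeff_pos n
    have h1 : HasSum (fun p : ℕ => (2 * (p : ℝ) + 1) * invSqrtCoeff p /
        ((2 * (p : ℝ) + 1 - 2 * n) * (2 * (p : ℝ) + 1 - 2 * n))) (arcsinOne / invSqrtCoeff n) := by
      have h2 : HasSum (fun p : ℕ => 2 * (n : ℝ) * (invSqrtCoeff p /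
          (2 * (p : ℝ) + 1 - 2 * n) ^ 2)) (if n = 0 then 0 else arcsinOne / invSqrtCoeff n) := by
        cases n with
        | zero => simp [hasSum_zero]
        | succ j =>
          refine ((hasSum_invSqrtCoeff_div_sq j).mul_left
            (2 * ((j + 1 : ℕ) : ℝ))).of_eq_of_eq (fun _ => rfl) ?_
          have hj := invSqrtCoeff_pos j
          rw [if_neg (Nat.succ_ne_zero j), invSqrtCoeff_succ_eq]
          push_cast
          field_simp
      refine ((hasSum_invSqrtCoeff_div n).add h2).of_eq_of_eq (fun p => ?_) ?_
      · have e1 := odd_ne_zero p n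
        field_simp
        ring
      · split_ifs with h
        · simp [h, invSqrtCoeff_zero]
        · simp
    refine (h1.mul_left (invSqrtCoeff n / arcsinOne)).of_eq_of_eq (fun _ => rfl) ?_
    field_simp
  · rw [if_neg hnk]
    have hne : ((k : ℝ) - n) ≠ 0 := sub_ne_zero.2 (by exact_mod_cast Ne.symm hnk)
    have h2 := ((((hz k).sub (hz n)).mul_left (1 / ((k : ℝ) - n)))).mul_left
      (√(invSqrtCoeff n) * √(invSqrtCoeff k) / arcsinOne)
    rw [sub_zero, mul_zero, mul_zero] at h2
    refine h2.congr_fun fun p => ?_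
    have e1 := odd_ne_zero p n
    have e2 := odd_ne_zero p k
    congr 1
    rw [mul_div_assoc', mul_div_assoc', div_sub_div _ _ e2 e1, div_mul_div_comm,
      div_eq_div_iff (by positivity) (by positivity)]
    ring

lemma summable_and_sq_tsum_le {v g : ℕ → ℝ} (hv : ∀ n, 0 < v n)
    (hv' : Summable (fun n => 1 / v n)) (hg : Summable (fun n => v n * g n ^ 2)) :
    Summable (fun n => |g n|) ∧ (∑' n, g n) ^ 2 ≤ (∑' n, 1 / v n) * ∑' n, v n * g n ^ 2 := by
  have habs : Summable (fun n => |g n|) := by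
    refine Summable.of_nonneg_of_le (fun n => abs_nonneg _) (fun n => ?_) (hg.add hv')
    have h := hv n
    have h1 : 0 ≤ v n * (|g n| - 1 / v n) ^ 2 := by positivity
    have h2 : v n * (|g n| - 1 / v n) ^ 2 = v n * g n ^ 2 - 2 * |g n| + 1 / v n := by
      rw [sub_sq, sq_abs]
      field_simp
    linarith [abs_nonneg (g n)]
  refine ⟨habs, ?_⟩
  have hgs : Summable g := habs.of_abs
  have hZ : 0 < ∑' n, 1 / v n :=
    hv'.tsum_pos (fun n => (one_div_pos.2 (hv n)).le) 0 (one_div_pos.2 (hv 0))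
  have key (t : ℝ) : 0 ≤ (∑' n, v n * g n ^ 2) - 2 * t * (∑' n, g n) + t ^ 2 * ∑' n, 1 / v n := by
    have h := (hg.hasSum.sub (hgs.hasSum.mul_left (2 * t))).add (hv'.hasSum.mul_left (t ^ 2))
    refine h.nonneg fun n => ?_
    have hn := hv n
    have h2 : v n * g n ^ 2 - 2 * t * g n + t ^ 2 * (1 / v n) = v n * (g n - t / v n) ^ 2 := by
      field_simp
      ring
    rw [h2]
    positivity
  have h := key ((∑' n, g n) / ∑' n, 1 / v n)
  have e : (∑' n, v n * g n ^ 2) - 2 * ((∑' n, g n) / ∑' n, 1 / v n) * (∑' n, g n)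
      + ((∑' n, g n) / ∑' n, 1 / v n) ^ 2 * ∑' n, 1 / v n
      = (∑' n, v n * g n ^ 2) - (∑' n, g n) ^ 2 / ∑' n, 1 / v n := by
    field_simp
    ring
  rw [e, sub_nonneg, div_le_iff₀ hZ] at h
  linarith

/-- The weight of `ℓ²_{3/4}`. -/
noncomputable def weight (n : ℕ) : ℝ := (1 + (n : ℝ)) ^ (2 * (3 / 4) : ℝ)

lemma weight_eq (n : ℕ) : weight n = ((n : ℝ) + 1) * √((n : ℝ) + 1) := by
  have h : (0 : ℝ) < n + 1 := by positivity
  rw [weight, Real.sqrt_eq_rpow, show (2 * (3 / 4) : ℝ) = 1 + 1 / 2 by norm_num, add_comm (1 : ℝ) n,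
    Real.rpow_add h, Real.rpow_one]

lemma weight_pos (n : ℕ) : 0 < weight n := by
  unfold weight
  positivity

lemma summable_one_div_weight_succ : Summable (fun n : ℕ => 1 / weight (n + 1)) := by
  have h : Summable (fun n : ℕ => 1 / (n : ℝ) ^ (2 * (3 / 4) : ℝ)) :=
    Real.summable_one_div_nat_rpow.2 (by norm_num)
  refine ((summable_nat_add_iff 2).2 h).congr fun n => ?_
  rw [weight]
  congr 2
  push_cast
  ring

/-- The weight making the range of `𝒜` an isometric copy of `ℓ²`. -/
noncomputable def rangeWeight (n : ℕ) : ℝ := (2 * (n : ℝ) + 1) ^ 2 * invSqrtCoeff n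

/-- The weight making the domain of `𝒜` an isometric copy of `ℓ²`. -/
noncomputable def domainWeight (p : ℕ) : ℝ :=
  (2 * (p : ℝ) + 2) ^ 2 / ((2 * (p : ℝ) + 1) * invSqrtCoeff p)

lemma rangeWeight_pos (n : ℕ) : 0 < rangeWeight n := by
  have := invSqrtCoeff_pos n
  unfold rangeWeight
  positivity

lemma domainWeight_pos (n : ℕ) : 0 < domainWeight n := by
  have := invSqrtCoeff_pos n
  unfold domainWeight
  positivity

lemma weight_le_rangeWeight (n : ℕ) : weight n ≤ 2 * rangeWeight n := by
  have h1 := le_invSqrtCoeff_mul_sqrt n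
  have hb := invSqrtCoeff_pos n
  have hq : 0 ≤ √((n : ℝ) + 1) := Real.sqrt_nonneg _
  have hq2 := Real.sq_sqrt (show (0 : ℝ) ≤ (n : ℝ) + 1 by positivity)
  have hn : (0 : ℝ) ≤ n := Nat.cast_nonneg n
  rw [weight_eq, rangeWeight]
  calc ((n : ℝ) + 1) * √((n : ℝ) + 1)
      ≤ ((n : ℝ) + 1) * √((n : ℝ) + 1) * (2 * (invSqrtCoeff n * √((n : ℝ) + 1))) :=
        le_mul_of_one_le_right (by positivity) h1
    _ = 2 * (((n : ℝ) + 1) * √((n : ℝ) + 1) ^ 2 * invSqrtCoeff n) := by ring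
    _ ≤ 2 * ((2 * (n : ℝ) + 1) ^ 2 * invSqrtCoeff n) := by
        rw [hq2]
        gcongr
        nlinarith

lemma rangeWeight_le_weight (n : ℕ) : rangeWeight n ≤ 4 * weight n := by
  have h1 := invSqrtCoeff_mul_sqrt_le n
  have hb := invSqrtCoeff_pos n
  have hq : 0 ≤ √((n : ℝ) + 1) := Real.sqrt_nonneg _
  have hq2 := Real.sq_sqrt (show (0 : ℝ) ≤ (n : ℝ) + 1 by positivity)
  have hn : (0 : ℝ) ≤ n := Nat.cast_nonneg n
  rw [weight_eq, rangeWeight]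
  calc (2 * (n : ℝ) + 1) ^ 2 * invSqrtCoeff n
      ≤ (4 * (((n : ℝ) + 1) * ((n : ℝ) + 1))) * invSqrtCoeff n := by
        gcongr
        nlinarith
    _ = (4 * (((n : ℝ) + 1) * √((n : ℝ) + 1))) * (invSqrtCoeff n * √((n : ℝ) + 1)) := by
        nth_rewrite 2 [← hq2]
        ring
    _ ≤ 4 * (((n : ℝ) + 1) * √((n : ℝ) + 1)) := mul_le_of_le_one_right (by positivity) h1

lemma weight_le_weight_succ (p : ℕ) : weight p ≤ weight (p + 1) := by
  rw [weight_eq, weight_eq]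
  push_cast
  gcongr <;> linarith

lemma weight_succ_le (p : ℕ) : weight (p + 1) ≤ 4 * weight p := by
  rw [weight_eq, weight_eq]
  have h : √((p : ℝ) + 1 + 1) ≤ 2 * √((p : ℝ) + 1) := by
    rw [Real.sqrt_le_left (by positivity), mul_pow, Real.sq_sqrt (by positivity)]
    linarith [(Nat.cast_nonneg p : (0 : ℝ) ≤ p)]
  push_cast
  calc ((p : ℝ) + 1 + 1) * √((p : ℝ) + 1 + 1) ≤ (2 * ((p : ℝ) + 1)) * (2 * √((p : ℝ) + 1)) := by
        gcongr
        linarith [(Nat.cast_nonneg p : (0 : ℝ) ≤ p)]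
    _ = _ := by ring

lemma weight_succ_le_domainWeight (p : ℕ) : weight (p + 1) ≤ 2 * domainWeight p := by
  have h1 := invSqrtCoeff_mul_sqrt_le p
  have hb := invSqrtCoeff_pos p
  have hn : (0 : ℝ) ≤ p := Nat.cast_nonneg p
  have h : 2 * weight p ≤ domainWeight p := by
    rw [weight_eq, domainWeight, le_div_iff₀ (by positivity)]
    calc 2 * (((p : ℝ) + 1) * √((p : ℝ) + 1)) * ((2 * (p : ℝ) + 1) * invSqrtCoeff p)
        = (2 * ((p : ℝ) + 1) * (2 * (p : ℝ) + 1)) * (invSqrtCoeff p * √((p : ℝ) + 1)) := by ring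
      _ ≤ 2 * ((p : ℝ) + 1) * (2 * (p : ℝ) + 1) := mul_le_of_le_one_right (by positivity) h1
      _ ≤ (2 * (p : ℝ) + 2) ^ 2 := by nlinarith
  linarith [weight_succ_le p]

lemma domainWeight_le_weight_succ (p : ℕ) : domainWeight p ≤ 8 * weight (p + 1) := by
  have h1 := le_invSqrtCoeff_mul_sqrt p
  have hb := invSqrtCoeff_pos p
  have hn : (0 : ℝ) ≤ p := Nat.cast_nonneg p
  have h : domainWeight p ≤ 8 * weight p := by
    rw [weight_eq, domainWeight, div_le_iff₀ (by positivity)]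
    calc (2 * (p : ℝ) + 2) ^ 2 ≤ 4 * ((p : ℝ) + 1) * (2 * (p : ℝ) + 1) := by nlinarith
      _ ≤ (4 * ((p : ℝ) + 1) * (2 * (p : ℝ) + 1)) * (2 * (invSqrtCoeff p * √((p : ℝ) + 1))) :=
        le_mul_of_one_le_right (by positivity) h1
      _ = _ := by ring
  linarith [weight_le_weight_succ p]

lemma memL2r_iff (f : ℕ → ℝ) :
    MemL2r (3 / 4) f ↔ Summable (fun n => weight n * f n ^ 2) := Iff.rfl

lemma normL2r_eq (f : ℕ → ℝ) : normL2r (3 / 4) f = √(∑' n, weight n * f n ^ 2) := by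
  rw [Real.sqrt_eq_rpow]
  rfl

lemma summable_abs_div {f : ℕ → ℝ} (hf : Summable (fun k => |f k|)) (n : ℕ) :
    Summable (fun k : ℕ => |f k / (2 * ((n : ℝ) - (k : ℝ)) + 1)|) := by
  refine Summable.of_nonneg_of_le (fun _ => abs_nonneg _) (fun k => ?_) hf
  have h := one_le_abs_odd n k
  rw [abs_div, show 2 * ((n : ℝ) - k) + 1 = 2 * n + 1 - 2 * k by ring]
  exact div_le_self (abs_nonneg _) h

lemma Aop_add {f g : ℕ → ℝ} (hf : Summable (fun k => |f k|)) (hg : Summable (fun k => |g k|))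
    (n : ℕ) : Aop (fun k => f k + g k) n = Aop f n + Aop g n := by
  rw [Aop, Aop, Aop, ← mul_add,
    ← (summable_abs_div hf n).of_abs.tsum_add (summable_abs_div hg n).of_abs]
  simp only [add_div]

lemma Aop_const_mul (c : ℝ) (f : ℕ → ℝ) (n : ℕ) :
    Aop (fun k => c * f k) n = c * Aop f n := by
  simp only [Aop, mul_div_assoc, tsum_mul_left]
  ring

/-- The vanishing sum of `f` improves the decay of the kernel of `𝒜`. -/
lemma mul_Aop_eq {f : ℕ → ℝ} (hf : Summable (fun k => |f k|)) (h0 : ∑' k, f k = 0) (n : ℕ) :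
    (2 * (n : ℝ) + 1) * Aop f n =
      -(2 / Real.pi) * ∑' p : ℕ, (2 * (p : ℝ) + 2) * f (p + 1) / (2 * (p : ℝ) + 1 - 2 * n) := by
  have hs := (summable_abs_div hf n).of_abs
  have e (k : ℕ) : (2 * (n : ℝ) + 1) * (f k / (2 * ((n : ℝ) - k) + 1)) - f k
      = 2 * k * f k / (2 * ((n : ℝ) - k) + 1) := by
    have h := odd_ne_zero n k
    rw [show 2 * ((n : ℝ) - k) + 1 = 2 * n + 1 - 2 * k by ring]
    field_simp
    ring
  have h1 := (hs.mul_left (2 * (n : ℝ) + 1)).sub hf.of_abs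
  have h2 : (2 * (n : ℝ) + 1) * ∑' k : ℕ, f k / (2 * ((n : ℝ) - k) + 1)
      = ∑' k : ℕ, 2 * (k : ℝ) * f k / (2 * ((n : ℝ) - k) + 1) := by
    rw [← tsum_mul_left, ← sub_zero (∑' k : ℕ, _ * _), ← h0,
      ← (hs.mul_left (2 * (n : ℝ) + 1)).tsum_sub hf.of_abs]
    exact tsum_congr e
  rw [Aop, mul_left_comm, h2, (h1.congr fun k => e k).tsum_eq_zero_add, neg_mul, ← mul_neg,
    ← tsum_neg]
  simp only [Nat.cast_zero, mul_zero, zero_mul, zero_div, zero_add]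
  congr 1
  refine tsum_congr fun p => ?_
  rw [show 2 * ((n : ℝ) - (p + 1 : ℕ)) + 1 = -(2 * (p : ℝ) + 1 - 2 * n) by push_cast; ring,
    div_neg]
  push_cast
  ring

/-- The scalar relating `𝒜` to the orthogonal matrix `orthoHilbert`. -/
noncomputable def scaleFactor : ℝ := -(2 / Real.pi) * √arcsinOne

lemma scaleFactor_ne_zero : scaleFactor ≠ 0 :=
  mul_ne_zero (neg_ne_zero.2 (div_ne_zero two_ne_zero Real.pi_ne_zero))
    (Real.sqrt_ne_zero'.2 arcsinOne_pos)

lemma sqrt_rangeWeight_mul_Aop {f : ℕ → ℝ} (hf : Summable (fun k => |f k|))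
    (h0 : ∑' k, f k = 0) (n : ℕ) :
    √(rangeWeight n) * Aop f n =
      scaleFactor * ∑' p, orthoHilbert p n * (√(domainWeight p) * f (p + 1)) := by
  have hs : √arcsinOne ≠ 0 := Real.sqrt_ne_zero'.2 arcsinOne_pos
  have e (p : ℕ) : √arcsinOne * (orthoHilbert p n * (√(domainWeight p) * f (p + 1)))
      = √(invSqrtCoeff n) * ((2 * (p : ℝ) + 2) * f (p + 1) / (2 * (p : ℝ) + 1 - 2 * n)) := by
    have hb := invSqrtCoeff_pos p
    have h1 : √((2 * (p : ℝ) + 1) * invSqrtCoeff p) ≠ 0 :=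
      Real.sqrt_ne_zero'.2 (by positivity)
    have h2 := odd_ne_zero p n
    rw [orthoHilbert, domainWeight, Real.sqrt_div (by positivity),
      Real.sqrt_sq (by positivity)]
    field_simp
  rw [rangeWeight, Real.sqrt_mul (by positivity), Real.sqrt_sq (by positivity),
    mul_comm _ (√(invSqrtCoeff n)), mul_assoc, mul_Aop_eq hf h0, scaleFactor, mul_assoc,
    ← tsum_mul_left (a := √arcsinOne), tsum_congr e, tsum_mul_left]
  ring

lemma sqrt_mul_sq {a : ℝ} (ha : 0 < a) (x : ℝ) : (√a * x) ^ 2 = a * x ^ 2 := by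
  rw [mul_pow, Real.sq_sqrt ha.le]

lemma summable_and_tsum_le_of_weight_le {v w f : ℕ → ℝ} {c : ℝ} (hv : ∀ n, 0 < v n)
    (h : ∀ n, v n ≤ c * w n) (hf : Summable (fun n => w n * f n ^ 2)) :
    Summable (fun n => v n * f n ^ 2) ∧
      ∑' n, v n * f n ^ 2 ≤ c * ∑' n, w n * f n ^ 2 := by
  have h1 (n : ℕ) : v n * f n ^ 2 ≤ c * (w n * f n ^ 2) := by
    rw [← mul_assoc]
    exact mul_le_mul_of_nonneg_right (h n) (sq_nonneg _)
  have hs : Summable (fun n => v n * f n ^ 2) :=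
    Summable.of_nonneg_of_le (fun n => mul_nonneg (hv n).le (sq_nonneg _)) h1 (hf.mul_left c)
  refine ⟨hs, ?_⟩
  rw [← tsum_mul_left]
  exact hs.tsum_le_tsum h1 (hf.mul_left c)

/-- `𝒜` is, up to a scalar, an isometry for suitable weights. -/
lemma hasSum_rangeWeight_Aop {f : ℕ → ℝ} (hf : MemV f) :
    Summable (fun p => domainWeight p * f (p + 1) ^ 2) ∧
    HasSum (fun n => rangeWeight n * Aop f n ^ 2)
      (scaleFactor ^ 2 * ∑' p, domainWeight p * f (p + 1) ^ 2) := by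
  obtain ⟨h2, h1, h0⟩ := hf
  have hy := (summable_and_tsum_le_of_weight_le domainWeight_pos domainWeight_le_weight_succ
    ((summable_nat_add_iff 1).2 ((memL2r_iff f).1 h2))).1
  refine ⟨hy, ?_⟩
  have hy' : Summable (fun p => (√(domainWeight p) * f (p + 1)) ^ 2) := by
    simpa only [sqrt_mul_sq (domainWeight_pos _)] using hy
  have h := (sum_sq_of_orthonormal_rows orthoHilbert_rows hy').mul_left (scaleFactor ^ 2)
  refine h.of_eq_of_eq (fun n => ?_) ?_
  · rw [← sqrt_mul_sq (rangeWeight_pos n), sqrt_rangeWeight_mul_Aop h1 h0, mul_pow]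
  · simp only [sqrt_mul_sq (domainWeight_pos _)]

lemma memL2r_Aop {f : ℕ → ℝ} (hf : MemV f) : MemL2r (3 / 4) (Aop f) :=
  (summable_and_tsum_le_of_weight_le weight_pos weight_le_rangeWeight
    (hasSum_rangeWeight_Aop hf).2.summable).1

lemma tsum_weight_Aop_le {f : ℕ → ℝ} (hf : MemV f) :
    ∑' n, weight n * Aop f n ^ 2 ≤ 16 * scaleFactor ^ 2 * ∑' n, weight n * f n ^ 2 := by
  obtain ⟨-, h2⟩ := hasSum_rangeWeight_Aop hf
  have hs := (memL2r_iff f).1 hf.1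
  have h3 := (summable_and_tsum_le_of_weight_le weight_pos weight_le_rangeWeight h2.summable).2
  have h4 := (summable_and_tsum_le_of_weight_le domainWeight_pos domainWeight_le_weight_succ
    ((summable_nat_add_iff 1).2 hs)).2
  have h5 : ∑' p, weight (p + 1) * f (p + 1) ^ 2 ≤ ∑' n, weight n * f n ^ 2 := by
    rw [hs.tsum_eq_zero_add]
    have := mul_nonneg (weight_pos 0).le (sq_nonneg (f 0))
    linarith
  rw [h2.tsum_eq] at h3
  nlinarith [sq_nonneg scaleFactor]

/-- The constant in the lower bound for `𝒜`. -/
noncomputable def lowerConst : ℝ :=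
  8 * (1 + ∑' n, 1 / weight (n + 1)) / scaleFactor ^ 2

lemma lowerConst_pos : 0 < lowerConst := by
  have h : 0 ≤ ∑' n, 1 / weight (n + 1) := tsum_nonneg fun n => (one_div_pos.2 (weight_pos _)).le
  have := scaleFactor_ne_zero
  unfold lowerConst
  positivity

lemma tsum_weight_le {f : ℕ → ℝ} (hf : MemV f) :
    ∑' n, weight n * f n ^ 2 ≤ lowerConst * ∑' n, weight n * Aop f n ^ 2 := by
  obtain ⟨h1, h2⟩ := hasSum_rangeWeight_Aop hf
  have hs := (memL2r_iff f).1 hf.1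
  have h3 := (summable_and_tsum_le_of_weight_le rangeWeight_pos rangeWeight_le_weight
    ((memL2r_iff _).1 (memL2r_Aop hf))).2
  have h4 := (summable_and_tsum_le_of_weight_le (fun p => weight_pos (p + 1))
    weight_succ_le_domainWeight h1).2
  have h5 := (summable_and_sq_tsum_le (fun p => weight_pos (p + 1)) summable_one_div_weight_succ
    ((summable_nat_add_iff 1).2 hs)).2
  have h0 := hf.2.2
  rw [hf.2.1.of_abs.tsum_eq_zero_add] at h0
  rw [← neg_eq_of_add_eq_zero_right h0, neg_sq] at h5
  have hw : weight 0 = 1 := by simp [weight]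
  have hZ : 0 ≤ ∑' n, 1 / weight (n + 1) := tsum_nonneg fun n => (one_div_pos.2 (weight_pos _)).le
  have hk : 0 < scaleFactor ^ 2 := by
    have := scaleFactor_ne_zero
    positivity
  rw [h2.tsum_eq] at h3
  rw [hs.tsum_eq_zero_add, hw, one_mul, lowerConst]
  set Z := ∑' n, 1 / weight (n + 1)
  set E := ∑' p, weight (p + 1) * f (p + 1) ^ 2
  set D := ∑' p, domainWeight p * f (p + 1) ^ 2
  set N := ∑' n, weight n * Aop f n ^ 2
  calc f 0 ^ 2 + E ≤ (1 + Z) * E := by linarith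
    _ ≤ (1 + Z) * (2 * (4 * N / scaleFactor ^ 2)) := by
        have : D ≤ 4 * N / scaleFactor ^ 2 := by
          rw [le_div_iff₀ hk]
          linarith
        gcongr
        linarith
    _ = 8 * (1 + Z) / scaleFactor ^ 2 * N := by
        field_simp
        ring

lemma MemV.eq_of_Aop_eq {f g : ℕ → ℝ} (hf : MemV f) (hg : MemV g) (h : Aop f = Aop g) :
    f = g := by
  have hmem : MemV (fun k => f k + (-1) * g k) := by
    refine ⟨?_, ?_, ?_⟩
    · rw [memL2r_iff]
      refine Summable.of_nonneg_of_le (fun n => mul_nonneg (weight_pos n).le (sq_nonneg _))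
        (fun n => ?_) ((((memL2r_iff f).1 hf.1).add ((memL2r_iff g).1 hg.1)).mul_left 2)
      rw [← mul_add, mul_left_comm]
      exact mul_le_mul_of_nonneg_left (by nlinarith [sq_nonneg (f n + g n)]) (weight_pos n).le
    · exact (hf.2.1.of_abs.add (hg.2.1.of_abs.mul_left (-1))).abs
    · rw [hf.2.1.of_abs.tsum_add (hg.2.1.of_abs.mul_left (-1)), tsum_mul_left, hf.2.2, hg.2.2]
      simp
  have hA (n : ℕ) : Aop (fun k => f k + (-1) * g k) n = 0 := by
    rw [Aop_add hf.2.1 (hg.2.1.of_abs.mul_left (-1)).abs, Aop_const_mul, h]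
    ring
  have hle := tsum_weight_le hmem
  simp only [hA] at hle
  simp only [ne_eq, OfNat.ofNat_ne_zero, not_false_eq_true, zero_pow, mul_zero, tsum_zero] at hle
  funext n
  have h1 := ((memL2r_iff _).1 hmem.1).le_tsum n
    (fun k _ => mul_nonneg (weight_pos k).le (sq_nonneg _))
  have h2 : (f n + (-1) * g n) ^ 2 ≤ 0 := by
    have := weight_pos n
    by_contra hc
    push Not at hc
    have := mul_pos this hc
    linarith
  have h3 := pow_eq_zero_iff two_ne_zero |>.1 (le_antisymm h2 (sq_nonneg _))
  linarith

lemma exists_memV_Aop_eq {h : ℕ → ℝ} (hh : MemL2r (3 / 4) h) :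
    ∃ f : ℕ → ℝ, MemV f ∧ Aop f = h := by
  have hk := scaleFactor_ne_zero
  have hx : Summable (fun n => (scaleFactor⁻¹ * (√(rangeWeight n) * h n)) ^ 2) := by
    simp only [mul_pow scaleFactor⁻¹, sqrt_mul_sq (rangeWeight_pos _)]
    exact (summable_and_tsum_le_of_weight_le rangeWeight_pos rangeWeight_le_weight
      ((memL2r_iff h).1 hh)).1.mul_left _
  obtain ⟨y, hy, hxy⟩ := exists_preimage_of_orthonormal orthoHilbert_rows orthoHilbert_columns hx
  let g (p : ℕ) : ℝ := y p / √(domainWeight p)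
  have hgy (p : ℕ) : √(domainWeight p) * g p = y p :=
    mul_div_cancel₀ _ (Real.sqrt_ne_zero'.2 (domainWeight_pos p))
  have hg : Summable (fun p => domainWeight p * g p ^ 2) := by
    simpa only [← sqrt_mul_sq (domainWeight_pos _), hgy] using hy
  have hgw := (summable_and_tsum_le_of_weight_le (fun p => weight_pos (p + 1))
    weight_succ_le_domainWeight hg).1
  have hgs := (summable_and_sq_tsum_le (fun p => weight_pos (p + 1)) summable_one_div_weight_succ
    hgw).1
  let f (k : ℕ) : ℝ := Nat.casesOn k (-∑' p, g p) g
  have hfs : Summable (fun k => |f k|) := (summable_nat_add_iff 1).1 hgs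
  have hf0 : ∑' k, f k = 0 := by
    rw [hfs.of_abs.tsum_eq_zero_add]
    exact neg_add_cancel _
  refine ⟨f, ⟨(summable_nat_add_iff 1).1 hgw, hfs, hf0⟩, funext fun n => ?_⟩
  have h1 := sqrt_rangeWeight_mul_Aop hfs hf0 n
  have h2 : ∑' p, orthoHilbert p n * (√(domainWeight p) * f (p + 1)) =
      scaleFactor⁻¹ * (√(rangeWeight n) * h n) := by
    rw [← hxy n]
    exact tsum_congr fun p => by rw [← hgy p]
  rw [h2, mul_inv_cancel_left₀ hk] at h1
  exact mul_left_cancel₀ (Real.sqrt_ne_zero'.2 (rangeWeight_pos n)) h1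

/-- `𝒜` is a linear bijection from `V` onto `ℓ²_{3/4}` with equivalent norms. -/
theorem stmt3 :
    (∀ f : ℕ → ℝ, MemV f → ∀ n : ℕ,
        Summable (fun k : ℕ => |f k / (2 * ((n : ℝ) - (k : ℝ)) + 1)|)) ∧
    (∀ f g : ℕ → ℝ, MemV f → MemV g → ∀ n : ℕ,
        Aop (fun k => f k + g k) n = Aop f n + Aop g n) ∧
    (∀ (c : ℝ) (f : ℕ → ℝ), MemV f → ∀ n : ℕ, Aop (fun k => c * f k) n = c * Aop f n) ∧
    (∀ f : ℕ → ℝ, MemV f → MemL2r (3 / 4) (Aop f)) ∧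
    (∀ f g : ℕ → ℝ, MemV f → MemV g → Aop f = Aop g → f = g) ∧
    (∀ h : ℕ → ℝ, MemL2r (3 / 4) h → ∃ f : ℕ → ℝ, MemV f ∧ Aop f = h) ∧
    (∃ C₁ C₂ : ℝ, 0 < C₁ ∧ 0 < C₂ ∧ ∀ f : ℕ → ℝ, MemV f →
      C₁ * normL2r (3 / 4) f ≤ normL2r (3 / 4) (Aop f) ∧
      normL2r (3 / 4) (Aop f) ≤ C₂ * normL2r (3 / 4) f) := by
  refine ⟨fun f hf => summable_abs_div hf.2.1, fun f g hf hg => Aop_add hf.2.1 hg.2.1,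
    fun c f _ => Aop_const_mul c f, fun f => memL2r_Aop, fun f g => MemV.eq_of_Aop_eq,
    fun h => exists_memV_Aop_eq, 1 / √lowerConst, √(16 * scaleFactor ^ 2), ?_, ?_,
    fun f hf => ⟨?_, ?_⟩⟩
  · exact one_div_pos.2 (Real.sqrt_pos.2 lowerConst_pos)
  · have := scaleFactor_ne_zero
    positivity
  · rw [normL2r_eq, normL2r_eq, one_div_mul_eq_div,
      div_le_iff₀ (Real.sqrt_pos.2 lowerConst_pos), mul_comm, ← Real.sqrt_mul lowerConst_pos.le]
    exact Real.sqrt_le_sqrt (tsum_weight_le hf)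
  · rw [normL2r_eq, normL2r_eq, ← Real.sqrt_mul (by positivity)]
    exact Real.sqrt_le_sqrt (tsum_weight_Aop_le hf)
end

section
/- Let v ∈ ℝ and let (μ_n)_{n≥0} be a real sequence such that |μ_n| ≤ C(n+1)^{−1/2} for some C > 0 and all n, the sequence ( μ_n − v(n+1)^{−1/2} )_{n≥0} belongs to ℓ²_{1/4}, and for every n: μ_n ≠ 0 and u(4n+3+μ_n)/(u'(4n+3)·μ_n) > 0. Define R⁽¹⁾_n = −2·log( u(4n+3+μ_n)/(u'(4n+3)·μ_n) ) + (2 w'(4n+3)/w(4n+3))·μ_n. Then the sequence ( R⁽¹⁾_n − (π² v²/48)·(n+1)^{−1} )_{n≥0} belongs to ℓ²_{3/4}. -/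
open scoped BigOperators

/-- `u(λ) = ψ₊⁰(0,λ) = cos((λ-1)π/4) 2^{(λ-1)/4} Γ((λ+1)/4) / √π`. -/
noncomputable def ufun (x : ℝ) : ℝ :=
  Real.cos ((x - 1) * Real.pi / 4) * (2 : ℝ) ^ ((x - 1) / 4) *
    Real.Gamma ((x + 1) / 4) / Real.sqrt Real.pi

/-- `w(λ) = (ψ₊⁰)'(0,λ) = sin((λ-1)π/4) 2^{(λ+3)/4} Γ((λ+3)/4) / √π`. -/
noncomputable def wfun (x : ℝ) : ℝ :=
  Real.sin ((x - 1) * Real.pi / 4) * (2 : ℝ) ^ ((x + 3) / 4) *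
    Real.Gamma ((x + 3) / 4) / Real.sqrt Real.pi

/-- Fourth-order estimate for the logarithm of `sin θ / θ` near the origin. -/
theorem abs_log_sin_div_add_sq_le {θ : ℝ} (h1 : |θ| ≤ 1) (h0 : θ ≠ 0) :
    0 < Real.sin θ / θ ∧ |Real.log (Real.sin θ / θ) + θ ^ 2 / 6| ≤ θ ^ 4 := by
  have hb := Real.sin_bound h1
  have hθ : 0 < |θ| := abs_pos.mpr h0
  set s := Real.sin θ / θ with hs
  have hsin : Real.sin θ = s * θ := by rw [hs]; field_simp
  have hb' : |s - (1 - θ ^ 2 / 6)| ≤ θ ^ 4 / 100 := by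
    have e1 : Real.sin θ - (θ - θ ^ 3 / 6) = (s - (1 - θ ^ 2 / 6)) * θ := by rw [hsin]; ring
    have e2 : |θ| ^ 5 / 100 = (θ ^ 4 / 100) * |θ| := by
      have : θ ^ 4 = |θ| ^ 4 := (Even.pow_abs (by decide) θ).symm
      rw [this]; ring
    rw [e1, abs_mul, e2] at hb
    exact le_of_mul_le_mul_right hb hθ
  obtain ⟨hl, hu⟩ := abs_le.mp hb'
  have hq : θ ^ 2 ≤ 1 := by rw [← sq_abs]; nlinarith
  have hq0 : 0 ≤ θ ^ 2 := sq_nonneg θ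
  have e4 : θ ^ 4 = (θ ^ 2) ^ 2 := by ring
  rw [e4] at hb' hl hu ⊢
  clear e4 hb'
  generalize θ ^ 2 = q at *
  have hs2 : 1 / 2 ≤ s := by nlinarith
  have hs0 : 0 < s := by linarith
  refine ⟨hs0, ?_⟩
  have up := Real.log_le_sub_one_of_pos hs0
  have lo := Real.one_sub_inv_le_log_of_pos hs0
  have hinv : s⁻¹ ≤ 1 - (s - 1) + 2 * (s - 1) ^ 2 := by
    rw [inv_le_iff_one_le_mul₀ hs0]
    nlinarith [mul_nonneg (sq_nonneg (s - 1)) (sub_nonneg.mpr hs2)]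
  have hd : (s - 1) ^ 2 ≤ (q / 5) ^ 2 := sq_le_sq' (by nlinarith) (by nlinarith)
  rw [abs_le]
  constructor <;> nlinarith

theorem log_Gamma_add_one {x : ℝ} (hx : 0 < x) :
    Real.log (Real.Gamma (x + 1)) = Real.log x + Real.log (Real.Gamma x) := by
  rw [Real.Gamma_add_one hx.ne', Real.log_mul hx.ne' (Real.Gamma_pos_of_pos hx).ne']

theorem differentiableAt_Gamma_of_pos {x : ℝ} (hx : 0 < x) :
    DifferentiableAt ℝ Real.Gamma x :=
  Real.differentiableAt_Gamma fun m hm => by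
    have : (0 : ℝ) ≤ m := m.cast_nonneg
    linarith

/-- Logarithmic bounds for the digamma function. -/
theorem log_le_deriv_Gamma_div_Gamma_le {x : ℝ} (hx : 1 < x) :
    Real.log (x - 1) ≤ deriv Real.Gamma x / Real.Gamma x ∧
      deriv Real.Gamma x / Real.Gamma x ≤ Real.log x := by
  have h0 : 0 < x := by linarith
  have hd : HasDerivAt (Real.log ∘ Real.Gamma) (deriv Real.Gamma x / Real.Gamma x) x :=
    (differentiableAt_Gamma_of_pos h0).hasDerivAt.log (Real.Gamma_pos_of_pos h0).ne'
  have hm : (0 : ℝ) < x - 1 := by linarith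
  constructor
  · have := Real.convexOn_log_Gamma.slope_le_of_hasDerivAt (x := x - 1) (y := x)
      hm h0 (by linarith) hd
    have e := log_Gamma_add_one hm
    rw [sub_add_cancel] at e
    simp only [slope_def_field, Function.comp, e] at this
    simpa using this
  · have := Real.convexOn_log_Gamma.le_slope_of_hasDerivAt (x := x) (y := x + 1)
      h0 (Set.mem_Ioi.mpr (by linarith)) (by linarith) hd
    simp only [slope_def_field, Function.comp, log_Gamma_add_one h0] at this
    simpa using this

/-- Logarithmic bounds for difference quotients of `log Γ`. -/
theorem log_le_log_Gamma_slope_le {x h : ℝ} (hx : 1 < x) (h1 : |h| ≤ 1) (h0 : h ≠ 0) :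
    Real.log (x - 1) ≤ (Real.log (Real.Gamma (x + h)) - Real.log (Real.Gamma x)) / h ∧
      (Real.log (Real.Gamma (x + h)) - Real.log (Real.Gamma x)) / h ≤ Real.log x := by
  obtain ⟨hl, hu⟩ := abs_le.mp h1
  have hx0 : 0 < x := by linarith
  have hm : (0 : ℝ) < x - 1 := by linarith
  have hxh : x + h ∈ Set.Ioi (0 : ℝ) := Set.mem_Ioi.mpr (by linarith)
  have hne : x + h ≠ x := by simpa using h0
  constructor
  · have := Real.convexOn_log_Gamma.secant_mono (a := x) (x := x - 1) (y := x + h)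
      hx0 hm hxh (by linarith) hne (by linarith)
    have e := log_Gamma_add_one hm
    rw [sub_add_cancel] at e
    simp only [Function.comp, add_sub_cancel_left] at this
    refine le_trans (le_of_eq ?_) this
    rw [e]
    ring
  · have := Real.convexOn_log_Gamma.secant_mono (a := x) (x := x + h) (y := x + 1)
      hx0 hxh (Set.mem_Ioi.mpr (by linarith)) hne (by linarith) (by linarith)
    simp only [Function.comp, add_sub_cancel_left, log_Gamma_add_one hx0] at this
    simpa using this

/-- Increments of `log Γ` are approximated to order `h / x` by the digamma function. -/
theorem abs_log_Gamma_sub_digamma_le {x h : ℝ} (hx : 2 ≤ x) (h1 : |h| ≤ 1) (h0 : h ≠ 0) :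
    |h * (deriv Real.Gamma (x + 1 / 2) / Real.Gamma (x + 1 / 2)) -
      (Real.log (Real.Gamma (x + h)) - Real.log (Real.Gamma x))| ≤ 3 * |h| / x := by
  obtain ⟨a1, a2⟩ := log_le_deriv_Gamma_div_Gamma_le (x := x + 1 / 2) (by linarith)
  obtain ⟨b1, b2⟩ := log_le_log_Gamma_slope_le (x := x) (by linarith) h1 h0
  set D := Real.log (Real.Gamma (x + h)) - Real.log (Real.Gamma x)
  set ψ := deriv Real.Gamma (x + 1 / 2) / Real.Gamma (x + 1 / 2)
  have hm : (0 : ℝ) < x - 1 := by linarith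
  have m1 : Real.log (x - 1) ≤ Real.log (x + 1 / 2 - 1) := Real.log_le_log hm (by linarith)
  have m2 : Real.log x ≤ Real.log (x + 1 / 2) := Real.log_le_log (by linarith) (by linarith)
  have m3 : Real.log (x + 1 / 2) - Real.log (x - 1) ≤ 3 / x := by
    rw [← Real.log_div (by linarith) hm.ne']
    refine (Real.log_le_sub_one_of_pos (div_pos (by linarith) hm)).trans ?_
    rw [div_sub_one hm.ne', div_le_div_iff₀ hm (by linarith)]
    nlinarith
  have key : |ψ - D / h| ≤ 3 / x := abs_le.mpr ⟨by linarith, by linarith⟩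
  have e : h * ψ - D = h * (ψ - D / h) := by field_simp
  rw [e, abs_mul]
  calc |h| * |ψ - D / h| ≤ |h| * (3 / x) := by gcongr
    _ = 3 * |h| / x := by ring

theorem cos_half_add_nat_mul_pi_add (n : ℕ) (t : ℝ) :
    Real.cos (Real.pi / 2 + t + n * Real.pi) = (-1) ^ n * -Real.sin t := by
  rw [Real.cos_add_nat_mul_pi, add_comm, Real.cos_add_pi_div_two]

theorem ufun_add (n : ℕ) (m : ℝ) :
    ufun (4 * (n : ℝ) + 3 + m) = (-1) ^ n * -Real.sin (Real.pi * (m / 4)) *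
      (2 : ℝ) ^ ((n : ℝ) + 1 / 2 + m / 4) * Real.Gamma ((n : ℝ) + 1 + m / 4) /
        Real.sqrt Real.pi := by
  rw [ufun, ← cos_half_add_nat_mul_pi_add]
  congr 4
  · ring
  · ring_nf
  · ring

theorem deriv_ufun (n : ℕ) :
    deriv ufun (4 * (n : ℝ) + 3) = (-1) ^ n * -(Real.pi / 4) *
      (2 : ℝ) ^ ((n : ℝ) + 1 / 2) * Real.Gamma ((n : ℝ) + 1) / Real.sqrt Real.pi := by
  have hΓ : DifferentiableAt ℝ Real.Gamma ((n : ℝ) + 1 + 0 / 4) :=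
    differentiableAt_Gamma_of_pos (by positivity)
  have hid : HasDerivAt (fun m : ℝ => m / 4) (1 / 4) 0 := (hasDerivAt_id _).div_const _
  have h1 : HasDerivAt (fun m : ℝ => Real.sin (Real.pi * (m / 4))) (Real.pi / 4) 0 := by
    convert (hid.const_mul Real.pi).sin using 1
    simp; ring
  have h2 := (hid.const_add ((n : ℝ) + 1 / 2)).const_rpow (a := 2) two_pos
  have h3 := HasDerivAt.comp (0 : ℝ) hΓ.hasDerivAt (hid.const_add ((n : ℝ) + 1))
  have h := (((h1.neg.const_mul ((-1 : ℝ) ^ n)).mul h2).mul h3).div_const (Real.sqrt Real.pi)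
  have e : deriv ufun (4 * (n : ℝ) + 3) =
      deriv (fun m => ufun (4 * (n : ℝ) + 3 + m)) 0 := by
    rw [deriv_comp_const_add, add_zero]
  rw [e, funext (ufun_add n)]
  refine HasDerivAt.deriv (h.congr_deriv ?_)
  simp

theorem wfun_add (n : ℕ) (m : ℝ) :
    wfun (4 * (n : ℝ) + 3 + m) = (-1) ^ n * Real.cos (Real.pi * (m / 4)) *
      (2 : ℝ) ^ ((n : ℝ) + 3 / 2 + m / 4) * Real.Gamma ((n : ℝ) + 3 / 2 + m / 4) /
        Real.sqrt Real.pi := by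
  have e : (-1) ^ n * Real.cos (Real.pi * (m / 4)) =
      Real.sin (Real.pi * (m / 4) + Real.pi / 2 + n * Real.pi) := by
    rw [Real.sin_add_nat_mul_pi, Real.sin_add_pi_div_two]
  rw [wfun, e]
  congr 4
  · ring
  · ring_nf
  · ring

theorem deriv_wfun_div_wfun (n : ℕ) :
    deriv wfun (4 * (n : ℝ) + 3) / wfun (4 * (n : ℝ) + 3) =
      Real.log 2 / 4 +
        deriv Real.Gamma ((n : ℝ) + 3 / 2) / Real.Gamma ((n : ℝ) + 3 / 2) / 4 := by
  have hΓ : DifferentiableAt ℝ Real.Gamma ((n : ℝ) + 3 / 2 + 0 / 4) :=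
    differentiableAt_Gamma_of_pos (by positivity)
  have hid : HasDerivAt (fun m : ℝ => m / 4) (1 / 4) 0 := (hasDerivAt_id _).div_const _
  have h1 : HasDerivAt (fun m : ℝ => Real.cos (Real.pi * (m / 4))) 0 0 := by
    convert (hid.const_mul Real.pi).cos using 1
    simp
  have h2 := (hid.const_add ((n : ℝ) + 3 / 2)).const_rpow (a := 2) two_pos
  have h3 := HasDerivAt.comp (0 : ℝ) hΓ.hasDerivAt (hid.const_add ((n : ℝ) + 3 / 2))
  have h := (((h1.const_mul ((-1 : ℝ) ^ n)).mul h2).mul h3).div_const (Real.sqrt Real.pi)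
  have e : deriv wfun (4 * (n : ℝ) + 3) =
      deriv (fun m => wfun (4 * (n : ℝ) + 3 + m)) 0 := by
    rw [deriv_comp_const_add, add_zero]
  have hd : deriv wfun (4 * (n : ℝ) + 3) = (-1) ^ n * (2 : ℝ) ^ ((n : ℝ) + 3 / 2) *
      (Real.log 2 / 4 * Real.Gamma ((n : ℝ) + 3 / 2) +
        deriv Real.Gamma ((n : ℝ) + 3 / 2) / 4) / Real.sqrt Real.pi := by
    rw [e, funext (wfun_add n)]
    refine HasDerivAt.deriv (h.congr_deriv ?_)
    simp
    ring
  have hw := wfun_add n 0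
  rw [add_zero] at hw
  rw [hd, hw]
  have hG : Real.Gamma ((n : ℝ) + 3 / 2) ≠ 0 := (Real.Gamma_pos_of_pos (by positivity)).ne'
  have hp : Real.sqrt Real.pi ≠ 0 := (Real.sqrt_pos.mpr Real.pi_pos).ne'
  have h2' : (2 : ℝ) ^ ((n : ℝ) + 3 / 2) ≠ 0 := (Real.rpow_pos_of_pos two_pos _).ne'
  have hs : ((-1 : ℝ)) ^ n ≠ 0 := pow_ne_zero _ (by norm_num)
  simp only [zero_div, mul_zero, Real.cos_zero, add_zero, mul_one]
  field_simp

theorem ufun_ratio (n : ℕ) {m : ℝ} (hm : m ≠ 0) :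
    ufun (4 * (n : ℝ) + 3 + m) / (deriv ufun (4 * (n : ℝ) + 3) * m) =
      Real.sin (Real.pi * (m / 4)) / (Real.pi * (m / 4)) * (2 : ℝ) ^ (m / 4) *
        (Real.Gamma ((n : ℝ) + 1 + m / 4) / Real.Gamma ((n : ℝ) + 1)) := by
  rw [ufun_add, deriv_ufun, Real.rpow_add two_pos]
  have hG : Real.Gamma ((n : ℝ) + 1) ≠ 0 := (Real.Gamma_pos_of_pos (by positivity)).ne'
  have hp : Real.sqrt Real.pi ≠ 0 := (Real.sqrt_pos.mpr Real.pi_pos).ne'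
  have hp' := Real.pi_ne_zero
  have h2' : (2 : ℝ) ^ ((n : ℝ) + 1 / 2) ≠ 0 := (Real.rpow_pos_of_pos two_pos _).ne'
  have hs : ((-1 : ℝ)) ^ n ≠ 0 := pow_ne_zero _ (by norm_num)
  field_simp

/-- The pointwise expansion `R⁽¹⁾_n = π² μ_n² / 48 + O(μ_n⁴ + |μ_n| / n)`. -/
theorem abs_remainder_sub_le {n : ℕ} (hn : 1 ≤ n) {m : ℝ} (hm : m ≠ 0)
    (h1 : |Real.pi * (m / 4)| ≤ 1) :
    |-2 * Real.log (ufun (4 * (n : ℝ) + 3 + m) / (deriv ufun (4 * (n : ℝ) + 3) * m))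
        + 2 * deriv wfun (4 * (n : ℝ) + 3) / wfun (4 * (n : ℝ) + 3) * m
        - Real.pi ^ 2 * m ^ 2 / 48| ≤
      2 * (Real.pi * (m / 4)) ^ 4 + 6 * |m / 4| / ((n : ℝ) + 1) := by
  have hn' : (1 : ℝ) ≤ n := by exact_mod_cast hn
  have hh : |m / 4| ≤ 1 := by
    rw [abs_mul, abs_of_pos Real.pi_pos] at h1
    nlinarith [Real.pi_gt_three, abs_nonneg (m / 4)]
  have hh0 : m / 4 ≠ 0 := div_ne_zero hm (by norm_num)
  obtain ⟨hs, hlog⟩ := abs_log_sin_div_add_sq_le h1 (mul_ne_zero Real.pi_ne_zero hh0)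
  have hΓ := abs_log_Gamma_sub_digamma_le (x := (n : ℝ) + 1) (by linarith) hh hh0
  have hG1 : 0 < Real.Gamma ((n : ℝ) + 1) := Real.Gamma_pos_of_pos (by positivity)
  have hG2 : 0 < Real.Gamma ((n : ℝ) + 1 + m / 4) :=
    Real.Gamma_pos_of_pos (by linarith [(abs_le.mp hh).1])
  have h2 : 0 < (2 : ℝ) ^ (m / 4) := Real.rpow_pos_of_pos two_pos _
  rw [mul_div_assoc, deriv_wfun_div_wfun, ufun_ratio n hm,
    Real.log_mul (mul_pos hs h2).ne' (div_pos hG2 hG1).ne', Real.log_mul hs.ne' h2.ne',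
    Real.log_rpow two_pos, Real.log_div hG2.ne' hG1.ne']
  rw [show (n : ℝ) + 1 + 1 / 2 = n + 3 / 2 by ring] at hΓ
  set L := Real.log (Real.sin (Real.pi * (m / 4)) / (Real.pi * (m / 4)))
  set ψ := deriv Real.Gamma ((n : ℝ) + 3 / 2) / Real.Gamma ((n : ℝ) + 3 / 2)
  obtain ⟨l1, l2⟩ := abs_le.mp hlog
  obtain ⟨g1, g2⟩ := abs_le.mp hΓ
  have e : 6 * |m / 4| / ((n : ℝ) + 1) = 2 * (3 * |m / 4| / ((n : ℝ) + 1)) := by ring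
  rw [e]
  refine abs_le.mpr ⟨?_, ?_⟩ <;> nlinarith

/-- The sequence `R⁽¹⁾_n - (π²v²/48)(n+1)⁻¹` lies in `ℓ²_{3/4}`, where
`R⁽¹⁾_n = -2 log( u(4n+3+μ_n)/(u'(4n+3) μ_n) ) + (2 w'(4n+3)/w(4n+3)) μ_n`. -/
theorem stmt13 (v : ℝ) (μ : ℕ → ℝ) (C : ℝ) (hC : 0 < C)
    (hbd : ∀ n : ℕ, |μ n| ≤ C * ((n : ℝ) + 1) ^ (-(1 : ℝ) / 2))
    (hl2 : MemL2r (1 / 4) (fun n : ℕ => μ n - v * ((n : ℝ) + 1) ^ (-(1 : ℝ) / 2)))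
    (hne : ∀ n : ℕ, μ n ≠ 0)
    (hpos : ∀ n : ℕ,
      0 < ufun (4 * (n : ℝ) + 3 + μ n) / (deriv ufun (4 * (n : ℝ) + 3) * μ n)) :
    MemL2r (3 / 4) (fun n : ℕ =>
      (-2 * Real.log (ufun (4 * (n : ℝ) + 3 + μ n) / (deriv ufun (4 * (n : ℝ) + 3) * μ n))
          + 2 * deriv wfun (4 * (n : ℝ) + 3) / wfun (4 * (n : ℝ) + 3) * μ n)
        - Real.pi ^ 2 * v ^ 2 / 48 * ((n : ℝ) + 1)⁻¹) := by
  have hrt : ∀ n : ℕ, 0 < (n : ℝ) + 1 := fun n => by positivity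
  set a : ℕ → ℝ := fun n => ((n : ℝ) + 1) ^ (-(1 : ℝ) / 2) with ha
  have ha0 : ∀ n, 0 < a n := fun n => Real.rpow_pos_of_pos (hrt n) _
  have ha2 : ∀ n : ℕ, ((n : ℝ) + 1)⁻¹ = a n ^ 2 := fun n => by
    rw [ha, ← Real.rpow_natCast, ← Real.rpow_mul (hrt n).le, ← Real.rpow_neg_one]
    norm_num
  have hw4 : ∀ n : ℕ, (1 + (n : ℝ)) ^ (2 * (1 / 4 : ℝ)) * a n = 1 := fun n => by
    rw [ha, add_comm, ← Real.rpow_add (hrt n)]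
    norm_num
  have hw34 : ∀ n : ℕ, (1 + (n : ℝ)) ^ (2 * (3 / 4 : ℝ)) * a n ^ 3 = 1 := fun n => by
    rw [ha, add_comm, ← Real.rpow_natCast, ← Real.rpow_mul (hrt n).le, ← Real.rpow_add (hrt n)]
    norm_num
  have hsum : Summable fun n => a n ^ 3 := by
    have := (summable_nat_add_iff 1).mpr
      (Real.summable_nat_rpow.mpr (by norm_num : (-(3 / 2) : ℝ) < -1))
    refine this.congr fun n => ?_
    rw [ha, ← Real.rpow_natCast, ← Real.rpow_mul (hrt n).le]
    push_cast
    norm_num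
  have hlim : Filter.Tendsto a Filter.atTop (nhds 0) := by
    have h := (tendsto_rpow_neg_atTop (y := 1 / 2) (by norm_num)).comp
      (Filter.tendsto_atTop_add_const_right _ (1 : ℝ) tendsto_natCast_atTop_atTop)
    refine h.congr fun n => ?_
    simp only [Function.comp, ha]
    norm_num
  have hsmall : ∀ᶠ n in Filter.atTop, Real.pi * (C * a n / 4) ≤ 1 := by
    have h : Filter.Tendsto (fun n => Real.pi * (C * a n / 4)) Filter.atTop (nhds 0) := by
      simpa using ((hlim.const_mul C).div_const 4).const_mul Real.pi
    exact h.eventually_le_const one_pos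
  set K := 2 * (Real.pi * (C / 4)) ^ 3 + 6 * (C / 4) with hK
  set B := Real.pi ^ 2 / 48 * (C + |v|) with hB
  unfold MemL2r at hl2 ⊢
  refine Summable.of_norm_bounded_eventually_nat
    ((hl2.mul_left (2 * B ^ 2)).add (hsum.mul_left (2 * K ^ 2))) ?_
  filter_upwards [hsmall, Filter.eventually_ge_atTop 1] with n hs hn
  have hμ : |μ n| ≤ C * a n := hbd n
  have hh : |μ n / 4| ≤ C * a n / 4 := by
    rw [abs_div, abs_of_pos (by norm_num : (0 : ℝ) < 4)]
    linarith
  have hθ : |Real.pi * (μ n / 4)| ≤ Real.pi * (C * a n / 4) := by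
    rw [abs_mul, abs_of_pos Real.pi_pos]
    exact mul_le_mul_of_nonneg_left hh Real.pi_pos.le
  have hR := abs_remainder_sub_le hn (hne n) (hθ.trans hs)
  set R := -2 * Real.log (ufun (4 * (n : ℝ) + 3 + μ n) / (deriv ufun (4 * (n : ℝ) + 3) * μ n))
          + 2 * deriv wfun (4 * (n : ℝ) + 3) / wfun (4 * (n : ℝ) + 3) * μ n
  change ‖(1 + (n : ℝ)) ^ (2 * (3 / 4 : ℝ)) *
      (R - Real.pi ^ 2 * v ^ 2 / 48 * ((n : ℝ) + 1)⁻¹) ^ 2‖ ≤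
    2 * B ^ 2 * ((1 + (n : ℝ)) ^ (2 * (1 / 4 : ℝ)) * (μ n - v * a n) ^ 2) + 2 * K ^ 2 * a n ^ 3
  have hR' : |R - Real.pi ^ 2 * μ n ^ 2 / 48| ≤ K * a n ^ 3 := by
    refine hR.trans ?_
    have t4 : (Real.pi * (μ n / 4)) ^ 4 ≤ (Real.pi * (C * a n / 4)) ^ 3 := by
      rw [← Even.pow_abs (by decide : Even 4)]
      calc |Real.pi * (μ n / 4)| ^ 4 = |Real.pi * (μ n / 4)| ^ 3 * |Real.pi * (μ n / 4)| := by ring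
        _ ≤ |Real.pi * (μ n / 4)| ^ 3 * 1 := by gcongr; exact hθ.trans hs
        _ ≤ (Real.pi * (C * a n / 4)) ^ 3 := by rw [mul_one]; gcongr
    have t1 : 6 * |μ n / 4| / ((n : ℝ) + 1) ≤ 6 * (C * a n / 4) * a n ^ 2 := by
      rw [div_eq_mul_inv, ha2 n]
      gcongr
    calc _ ≤ 2 * (Real.pi * (C * a n / 4)) ^ 3 + 6 * (C * a n / 4) * a n ^ 2 := by linarith
      _ = K * a n ^ 3 := by rw [hK]; ring
  have hM : |Real.pi ^ 2 * μ n ^ 2 / 48 - Real.pi ^ 2 * v ^ 2 / 48 * a n ^ 2| ≤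
      B * a n * |μ n - v * a n| := by
    have e : Real.pi ^ 2 * μ n ^ 2 / 48 - Real.pi ^ 2 * v ^ 2 / 48 * a n ^ 2 =
        Real.pi ^ 2 / 48 * (μ n + v * a n) * (μ n - v * a n) := by ring
    have hadd : |μ n + v * a n| ≤ (C + |v|) * a n := by
      refine (abs_add_le _ _).trans ?_
      rw [abs_mul v, abs_of_pos (ha0 n)]
      linarith
    rw [e, abs_mul, abs_mul, abs_of_pos (by positivity : 0 < Real.pi ^ 2 / 48)]
    rw [hB, mul_assoc _ (C + |v|)]
    gcongr
  have hE : |R - Real.pi ^ 2 * v ^ 2 / 48 * a n ^ 2| ≤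
      B * a n * |μ n - v * a n| + K * a n ^ 3 := by
    have := abs_add_le (R - Real.pi ^ 2 * μ n ^ 2 / 48)
      (Real.pi ^ 2 * μ n ^ 2 / 48 - Real.pi ^ 2 * v ^ 2 / 48 * a n ^ 2)
    rw [sub_add_sub_cancel] at this
    linarith
  have hE2 : (R - Real.pi ^ 2 * v ^ 2 / 48 * a n ^ 2) ^ 2 ≤
      2 * B ^ 2 * a n ^ 2 * (μ n - v * a n) ^ 2 + 2 * K ^ 2 * a n ^ 6 := by
    rw [← sq_abs]
    calc _ ≤ (B * a n * |μ n - v * a n| + K * a n ^ 3) ^ 2 := by gcongr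
      _ ≤ 2 * ((B * a n * |μ n - v * a n|) ^ 2 + (K * a n ^ 3) ^ 2) := add_sq_le
      _ = _ := by rw [mul_pow, mul_pow, sq_abs]; ring
  have hW0 : 0 < (1 + (n : ℝ)) ^ (2 * (3 / 4 : ℝ)) := Real.rpow_pos_of_pos (by positivity) _
  have h4 := hw4 n
  have h34 := hw34 n
  rw [ha2 n, Real.norm_of_nonneg (mul_nonneg hW0.le (sq_nonneg _))]
  set W := (1 + (n : ℝ)) ^ (2 * (3 / 4 : ℝ))
  set V := (1 + (n : ℝ)) ^ (2 * (1 / 4 : ℝ))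
  have hWV : W * a n ^ 2 = V :=
    mul_right_cancel₀ (ha0 n).ne' (by rw [h4, ← h34]; ring)
  calc _ ≤ W * (2 * B ^ 2 * a n ^ 2 * (μ n - v * a n) ^ 2 + 2 * K ^ 2 * a n ^ 6) := by gcongr
    _ = 2 * B ^ 2 * ((W * a n ^ 2) * (μ n - v * a n) ^ 2)
        + 2 * K ^ 2 * ((W * a n ^ 3) * a n ^ 3) := by ring
    _ = _ := by rw [hWV, h34, one_mul]
end

section
/- Let v ∈ ℝ and let (μ_n)_{n≥0} be a real sequence such that |μ_n| ≤ 1 for all n, |μ_n| ≤ C(n+1)^{−1/2} for some C > 0 and all n, the sequence ( μ_n − v(n+1)^{−1/2} )_{n≥0} belongs to ℓ²_{1/4}, and the sequence (4n + μ_n)_{n≥0} is strictly increasing. Then for each n ≥ 0 every argument 1 − μ_m/(4(n−m)+μ_n) (m ≠ n) is positive, the series R⁽²⁾_n = −Σ_{m≥0, m≠n} ( 2·log( 1 − μ_m/(4(n−m)+μ_n) ) + μ_m/(2(n−m)) ) converges absolutely, and the sequence ( R⁽²⁾_n + (π² v²/48)·(n+1)^{−1} )_{n≥0} belongs to ℓ²_{3/4}.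 -/
open scoped BigOperators

/-- Weak form of the second order expansion of `2 log (1 - x / (4 d + y)) + x / (2 d)`. -/
lemma abs_two_mul_log_sub_le {x y d : ℝ} (hx : |x| ≤ 1) (hy : |y| ≤ 1) (hd : 1 ≤ |d|) :
    0 < 1 - x / (4 * d + y) ∧
    |2 * Real.log (1 - x / (4 * d + y)) + x / (2 * d) - (2 * x * y - x ^ 2) / (16 * d ^ 2)|
      ≤ (|x| ^ 3 + |y| ^ 3) / |d| ^ 3 := by
  have hd0 : d ≠ 0 := by rintro rfl; norm_num at hd
  have hdp : 0 < |d| := by linarith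
  have hw : 3 * |d| ≤ |4 * d + y| := by
    have h := abs_sub_abs_le_abs_sub (4 * d) (-y)
    rw [abs_mul, abs_neg, sub_neg_eq_add] at h
    norm_num at h
    linarith
  have hwp : 0 < |4 * d + y| := by linarith
  have hw0 : 4 * d + y ≠ 0 := abs_pos.mp hwp
  set t := x / (4 * d + y) with ht
  have ht1 : |t| ≤ |x| / (3 * |d|) := by
    rw [ht, abs_div]; gcongr
  have ht3 : |t| ≤ 1 / 3 := by
    refine ht1.trans ?_
    rw [div_le_div_iff₀ (by positivity) (by norm_num)]
    linarith
  have htlt : |t| < 1 := by linarith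
  refine ⟨by linarith [le_abs_self t], ?_⟩
  have hlog := Real.abs_log_sub_add_sum_range_le htlt 2
  simp only [Finset.sum_range_succ, Finset.sum_range_zero] at hlog
  norm_num at hlog
  have hlog2 : |t| ^ 3 / (1 - |t|) ≤ (3 / 2) * |t| ^ 3 := by
    rw [div_le_iff₀ (by linarith)]
    nlinarith [pow_nonneg (abs_nonneg t) 3]
  have ht_cube : |t| ^ 3 ≤ |x| ^ 3 / (27 * |d| ^ 3) := by
    calc |t| ^ 3 ≤ (|x| / (3 * |d|)) ^ 3 := by gcongr
      _ = _ := by rw [div_pow]; ring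
  have hid : 2 * Real.log (1 - t) + x / (2 * d) - (2 * x * y - x ^ 2) / (16 * d ^ 2)
      = 2 * (t + t ^ 2 / 2 + Real.log (1 - t)) + (-(x * y ^ 2) / (8 * d ^ 2 * (4 * d + y)))
        + (x ^ 2 * y * (8 * d + y)) / (16 * d ^ 2 * (4 * d + y) ^ 2) := by
    rw [ht]; field_simp; ring
  have hb : |-(x * y ^ 2) / (8 * d ^ 2 * (4 * d + y))| ≤ |x| * |y| ^ 2 / (24 * |d| ^ 3) := by
    rw [abs_div, abs_neg, abs_mul, abs_mul, abs_mul, abs_pow, abs_pow]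
    calc |x| * |y| ^ 2 / (|8| * |d| ^ 2 * |4 * d + y|)
        ≤ |x| * |y| ^ 2 / (|8| * |d| ^ 2 * (3 * |d|)) := by gcongr
      _ = _ := by rw [abs_of_pos (by norm_num : (0 : ℝ) < 8)]; field_simp; ring
  have hc : |(x ^ 2 * y * (8 * d + y)) / (16 * d ^ 2 * (4 * d + y) ^ 2)|
      ≤ |x| ^ 2 * |y| / (16 * |d| ^ 3) := by
    have h9 : |8 * d + y| ≤ 9 * |d| := by
      have h := abs_add_le (8 * d) y
      rw [abs_mul] at h; norm_num at h; linarith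
    rw [abs_div, abs_mul, abs_mul, abs_mul, abs_mul, abs_pow, abs_pow, abs_pow]
    calc |x| ^ 2 * |y| * |8 * d + y| / (|16| * |d| ^ 2 * |4 * d + y| ^ 2)
        ≤ |x| ^ 2 * |y| * (9 * |d|) / (|16| * |d| ^ 2 * (3 * |d|) ^ 2) := by gcongr
      _ = _ := by rw [abs_of_pos (by norm_num : (0 : ℝ) < 16)]; field_simp; norm_num
  have hX := abs_nonneg x
  have hY := abs_nonneg y
  have hm1 : |x| * |y| ^ 2 ≤ |x| ^ 3 + |y| ^ 3 := by
    rcases le_total |x| |y| with h | h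
    · nlinarith [pow_nonneg hX 3, mul_le_mul_of_nonneg_right h (sq_nonneg |y|)]
    · nlinarith [pow_nonneg hY 3, mul_le_mul_of_nonneg_left (pow_le_pow_left₀ hY h 2) hX]
  have hm2 : |x| ^ 2 * |y| ≤ |x| ^ 3 + |y| ^ 3 := by
    rcases le_total |x| |y| with h | h
    · nlinarith [pow_nonneg hX 3, mul_le_mul_of_nonneg_right (pow_le_pow_left₀ hX h 2) hY]
    · nlinarith [pow_nonneg hY 3, mul_le_mul_of_nonneg_left h (sq_nonneg |x|)]
  rw [hid]
  have h3 := abs_add_three (2 * (t + t ^ 2 / 2 + Real.log (1 - t)))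
    (-(x * y ^ 2) / (8 * d ^ 2 * (4 * d + y)))
    ((x ^ 2 * y * (8 * d + y)) / (16 * d ^ 2 * (4 * d + y) ^ 2))
  rw [abs_mul 2] at h3
  norm_num at h3
  have e1 : |x| ^ 3 / (27 * |d| ^ 3) = (1 / 27) * (|x| ^ 3 / |d| ^ 3) := by field_simp
  have e2 : |x| * |y| ^ 2 / (24 * |d| ^ 3) ≤ (1 / 24) * ((|x| ^ 3 + |y| ^ 3) / |d| ^ 3) := by
    rw [show |x| * |y| ^ 2 / (24 * |d| ^ 3) = (1 / 24) * (|x| * |y| ^ 2 / |d| ^ 3) by field_simp]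
    gcongr
  have e3 : |x| ^ 2 * |y| / (16 * |d| ^ 3) ≤ (1 / 16) * ((|x| ^ 3 + |y| ^ 3) / |d| ^ 3) := by
    rw [show |x| ^ 2 * |y| / (16 * |d| ^ 3) = (1 / 16) * (|x| ^ 2 * |y| / |d| ^ 3) by field_simp]
    gcongr
  have e4 : (|x| ^ 3 + |y| ^ 3) / |d| ^ 3 = |x| ^ 3 / |d| ^ 3 + |y| ^ 3 / |d| ^ 3 := add_div _ _ _
  have e5 : 0 ≤ |x| ^ 3 / |d| ^ 3 := by positivity
  have e6 : 0 ≤ |y| ^ 3 / |d| ^ 3 := by positivity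
  linarith

/-- The kernel `|k|^{-3/2}` on the integers, vanishing at `0`. -/
noncomputable def cubeKernel (k : ℤ) : ℝ := ((√|(k : ℝ)|) ^ 3)⁻¹

lemma cubeKernel_nonneg (k : ℤ) : 0 ≤ cubeKernel k := by unfold cubeKernel; positivity

lemma summable_cubeKernel : Summable cubeKernel := by
  have h := Real.summable_abs_int_rpow (b := 3 / 2) (by norm_num)
  refine h.congr fun k => ?_
  rw [cubeKernel, Real.sqrt_eq_rpow, ← Real.rpow_natCast, ← Real.rpow_mul (abs_nonneg _),
    Real.rpow_neg (abs_nonneg _)]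
  norm_num

lemma one_le_abs_intCast {k : ℤ} (hk : k ≠ 0) : 1 ≤ |(k : ℝ)| := by
  exact_mod_cast Int.one_le_abs hk

lemma inv_sq_le_cubeKernel (k : ℤ) : ((k : ℝ) ^ 2)⁻¹ ≤ cubeKernel k := by
  rcases eq_or_ne k 0 with rfl | hk
  · simp [cubeKernel]
  have h1 := one_le_abs_intCast hk
  have h2 : 1 ≤ √|(k : ℝ)| := Real.one_le_sqrt.mpr h1
  have h3 : (k : ℝ) ^ 2 = √|(k : ℝ)| ^ 4 := by
    rw [show √|(k : ℝ)| ^ 4 = (√|(k : ℝ)| ^ 2) ^ 2 by ring, Real.sq_sqrt (abs_nonneg _), sq_abs]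
  rw [h3, cubeKernel]
  exact inv_anti₀ (by positivity) (pow_le_pow_right₀ h2 (by norm_num))

lemma injective_natCast_sub (n : ℕ) : Function.Injective fun m : ℕ => (n : ℤ) - m :=
  fun a b h => by simpa using h

/-- Discrete convolution of summable nonnegative functions. -/
lemma summable_convolution {f : ℕ → ℝ} {g : ℤ → ℝ} (hf0 : ∀ m, 0 ≤ f m) (hg0 : ∀ k, 0 ≤ g k)
    (hf : Summable f) (hg : Summable g) :
    (∀ n : ℕ, Summable fun m : ℕ => f m * g (n - m)) ∧
    Summable fun n : ℕ => ∑' m : ℕ, f m * g (n - m) := by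
  have h := hf.mul_of_nonneg hg hf0 hg0
  have hi : Function.Injective fun p : ℕ × ℕ => (p.2, (p.1 : ℤ) - p.2) := by
    rintro ⟨a, b⟩ ⟨c, d⟩ hp
    simp only [Prod.mk.injEq] at hp ⊢
    omega
  have h2 : Summable fun p : ℕ × ℕ => f p.2 * g ((p.1 : ℤ) - p.2) := h.comp_injective hi
  exact ⟨fun n => h2.prod_factor n, h2.prod⟩

lemma hasSum_int_inv_sq : HasSum (fun k : ℤ => ((k : ℝ) ^ 2)⁻¹) (Real.pi ^ 2 / 3) := by
  have h : HasSum (fun n : ℕ => ((n : ℝ) ^ 2)⁻¹) (Real.pi ^ 2 / 6) := by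
    simpa using hasSum_zeta_two
  have h' := (hasSum_nat_add_iff' 1).mpr h
  have := HasSum.of_nat_of_neg_add_one (f := fun k : ℤ => ((k : ℝ) ^ 2)⁻¹)
    (m := Real.pi ^ 2 / 6) (m' := Real.pi ^ 2 / 6) (by simpa using h) ?_
  · convert this using 1; ring
  · simp only [Finset.range_one, Finset.sum_singleton, Nat.cast_zero, ne_eq, OfNat.ofNat_ne_zero,
      not_false_eq_true, zero_pow, inv_zero, sub_zero] at h'
    refine h'.congr_fun fun n => ?_
    push_cast
    rw [neg_sq]

lemma sqrt_succ_sq (n : ℕ) : √((n : ℝ) + 1) ^ 2 = n + 1 := Real.sq_sqrt (by positivity)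

lemma one_le_sqrt_succ (n : ℕ) : 1 ≤ √((n : ℝ) + 1) := Real.one_le_sqrt.mpr (by simp)

lemma summable_inv_sqrt_succ_cube : Summable fun n : ℕ => (√((n : ℝ) + 1) ^ 3)⁻¹ := by
  have h := summable_cubeKernel.comp_injective (i := fun n : ℕ => (n : ℤ) + 1)
    (fun a b h => by simpa using h)
  refine h.congr fun n => ?_
  simp only [Function.comp, cubeKernel]
  push_cast
  rw [abs_of_nonneg (by positivity)]

/-- Truncating the integer sum of inverse squares to indices `m ≥ 0` costs `O((n + 1)^{-1/2})`. -/
lemma abs_tsum_inv_sq_sub_le (n : ℕ) :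
    Summable (fun m : ℕ => ((((n : ℤ) - m : ℤ) : ℝ) ^ 2)⁻¹) ∧
    |∑' m : ℕ, ((((n : ℤ) - m : ℤ) : ℝ) ^ 2)⁻¹ - Real.pi ^ 2 / 3|
      ≤ (√((n : ℝ) + 1))⁻¹ * ∑' m : ℕ, (√((m : ℝ) + 1) ^ 3)⁻¹ := by
  have hS : HasSum (fun k : ℤ => ((((n : ℤ) - k : ℤ) : ℝ) ^ 2)⁻¹) (Real.pi ^ 2 / 3) :=
    (Equiv.subLeft (n : ℤ)).hasSum_iff.mpr hasSum_int_inv_sq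
  have h1 : Summable (fun m : ℕ => ((((n : ℤ) - m : ℤ) : ℝ) ^ 2)⁻¹) :=
    hS.summable.comp_injective Nat.cast_injective
  have h2 : Summable (fun m : ℕ => ((((n : ℤ) - (-((m : ℤ) + 1)) : ℤ) : ℝ) ^ 2)⁻¹) :=
    hS.summable.comp_injective (i := fun m : ℕ => -((m : ℤ) + 1)) (fun a b h => by simpa using h)
  refine ⟨h1, ?_⟩
  have h3 := (HasSum.of_nat_of_neg_add_one (f := fun k : ℤ => ((((n : ℤ) - k : ℤ) : ℝ) ^ 2)⁻¹)
    h1.hasSum h2.hasSum).unique hS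
  have h4 : ∀ m : ℕ, ((((n : ℤ) - (-((m : ℤ) + 1)) : ℤ) : ℝ) ^ 2)⁻¹
      ≤ (√((n : ℝ) + 1))⁻¹ * (√((m : ℝ) + 1) ^ 3)⁻¹ := by
    intro m
    rw [← mul_inv]
    have ha := one_le_sqrt_succ n
    have hb := one_le_sqrt_succ m
    have ha2 := sqrt_succ_sq n
    have hb2 := sqrt_succ_sq m
    refine inv_anti₀ (by positivity) ?_
    push_cast
    rw [show (n : ℝ) - (-((m : ℝ) + 1)) = n + m + 1 by ring]
    set a := √((n : ℝ) + 1)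
    set b := √((m : ℝ) + 1)
    have hab : a * b ≤ n + m + 1 := by nlinarith [sq_nonneg (a - b)]
    have hbb : b ^ 2 ≤ n + m + 1 := by rw [hb2]; linarith [(Nat.cast_nonneg n : (0 : ℝ) ≤ n)]
    calc a * b ^ (3 : ℕ) = (a * b) * b ^ (2 : ℕ) := by ring
      _ ≤ ((n : ℝ) + m + 1) * (n + m + 1) := by gcongr
      _ = _ := by ring
  have h5 := h2.tsum_le_tsum h4 (summable_inv_sqrt_succ_cube.mul_left _)
  rw [tsum_mul_left] at h5
  have h6 : 0 ≤ ∑' m : ℕ, ((((n : ℤ) - (-((m : ℤ) + 1)) : ℤ) : ℝ) ^ 2)⁻¹ :=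
    tsum_nonneg fun m => by positivity
  rw [abs_le]
  constructor <;> linarith

lemma sqrt_succ_le_two_mul {n m : ℕ} (h : m ≠ n) :
    √((n : ℝ) + 1) ≤ 2 * √((m : ℝ) + 1) * √|(((n : ℤ) - m : ℤ) : ℝ)| := by
  have hd : 1 ≤ |(((n : ℤ) - m : ℤ) : ℝ)| := one_le_abs_intCast (by omega)
  refine Real.sqrt_le_iff.mpr ⟨by positivity, ?_⟩
  rw [mul_pow, mul_pow, sqrt_succ_sq, Real.sq_sqrt (abs_nonneg _)]
  have h2 : (n : ℝ) - m ≤ |(((n : ℤ) - m : ℤ) : ℝ)| := by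
    push_cast; exact le_abs_self _
  nlinarith [(Nat.cast_nonneg m : (0 : ℝ) ≤ m)]

lemma abs_intCast_eq_sq_sqrt (k : ℤ) : |(k : ℝ)| = √|(k : ℝ)| ^ 2 :=
  (Real.sq_sqrt (abs_nonneg _)).symm

/-- The `m`-th term of the series equals `μ_n² / (16 (n - m)²)` up to a summable error. -/
lemma abs_term_sub_le {v C : ℝ} {μ : ℕ → ℝ} (hC : 0 < C) (h1 : ∀ n, |μ n| ≤ 1)
    (hbd : ∀ n : ℕ, |μ n| ≤ C / √((n : ℝ) + 1)) (n m : ℕ) :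
    |(if m = n then (0 : ℝ) else
        (2 * Real.log (1 - μ m / (4 * ((n : ℝ) - (m : ℝ)) + μ n))
          + μ m / (2 * ((n : ℝ) - (m : ℝ))))) - μ n ^ 2 / 16 * ((((n : ℤ) - m : ℤ) : ℝ) ^ 2)⁻¹|
      ≤ 9 * C ^ 3 * (√((n : ℝ) + 1) ^ 3)⁻¹ * cubeKernel (n - m)
        + 3 / 16 * (v ^ 2 * (√((n : ℝ) + 1) ^ 3)⁻¹ * (√((m : ℝ) + 1) ^ 3)⁻¹
          + (μ n - v / √((n : ℝ) + 1)) ^ 2 * ((((n : ℤ) - m : ℤ) : ℝ) ^ 2)⁻¹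
          + (μ m - v / √((m : ℝ) + 1)) ^ 2 * ((((n : ℤ) - m : ℤ) : ℝ) ^ 2)⁻¹) := by
  rcases eq_or_ne m n with rfl | hmn
  · have := cubeKernel_nonneg ((m : ℤ) - m)
    simp only [if_true, sub_self, Int.cast_zero, ne_eq, OfNat.ofNat_ne_zero, not_false_eq_true,
      zero_pow, inv_zero, mul_zero, abs_zero, add_zero] at this ⊢
    positivity
  rw [if_neg hmn]
  have hd : 1 ≤ |(((n : ℤ) - m : ℤ) : ℝ)| := one_le_abs_intCast (by omega)
  have hs := sqrt_succ_le_two_mul hmn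
  have hδ := abs_intCast_eq_sq_sqrt ((n : ℤ) - m)
  have hcast : (((n : ℤ) - m : ℤ) : ℝ) = (n : ℝ) - m := by push_cast; rfl
  have hκ : cubeKernel ((n : ℤ) - m) = ((√|(n : ℝ) - m|) ^ 3)⁻¹ := by rw [cubeKernel, hcast]
  rw [hκ]
  rw [hcast] at hd hs hδ ⊢
  have hT := (abs_two_mul_log_sub_le (h1 m) (h1 n) hd).2
  have hx := hbd m
  have hy := hbd n
  have ha1 := one_le_sqrt_succ n
  have hb1 := one_le_sqrt_succ m
  have hδ1 : 1 ≤ √|(n : ℝ) - m| := Real.one_le_sqrt.mpr hd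
  have hsub : (n : ℝ) - m = √((n : ℝ) + 1) ^ 2 - √((m : ℝ) + 1) ^ 2 := by
    rw [sqrt_succ_sq, sqrt_succ_sq]; ring
  have hd0 : (n : ℝ) - m ≠ 0 := abs_pos.mp (by linarith)
  generalize hdd : (n : ℝ) - m = d at *
  generalize √((n : ℝ) + 1) = a at *
  generalize √((m : ℝ) + 1) = b at *
  generalize μ m = x at *
  generalize μ n = y at *
  generalize √|d| = δ at *
  have hcube : (|x| ^ 3 + |y| ^ 3) / |d| ^ 3 ≤ 9 * C ^ 3 * (a ^ 3)⁻¹ * (δ ^ 3)⁻¹ := by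
    have e1 : (b ^ 3 * δ ^ 3)⁻¹ ≤ 8 * (a ^ 3)⁻¹ := by
      rw [← div_eq_mul_inv, inv_eq_one_div, div_le_div_iff₀ (by positivity) (by positivity)]
      calc 1 * a ^ 3 ≤ 1 * (2 * b * δ) ^ 3 := by gcongr
        _ = _ := by ring
    have e2 : (δ ^ 3)⁻¹ ≤ 1 := inv_le_one_of_one_le₀ (one_le_pow₀ hδ1)
    rw [hδ, add_div]
    have e3 : |x| ^ 3 / (δ ^ 2) ^ 3 ≤ C ^ 3 * (8 * (a ^ 3)⁻¹) * (δ ^ 3)⁻¹ := by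
      calc |x| ^ 3 / (δ ^ 2) ^ 3 ≤ (C / b) ^ 3 / (δ ^ 2) ^ 3 := by gcongr
        _ = C ^ 3 * (b ^ 3 * δ ^ 3)⁻¹ * (δ ^ 3)⁻¹ := by field_simp
        _ ≤ _ := by gcongr
    have e4 : |y| ^ 3 / (δ ^ 2) ^ 3 ≤ C ^ 3 * (a ^ 3)⁻¹ * (δ ^ 3)⁻¹ := by
      calc |y| ^ 3 / (δ ^ 2) ^ 3 ≤ (C / a) ^ 3 / (δ ^ 2) ^ 3 := by gcongr
        _ = C ^ 3 * (a ^ 3)⁻¹ * (δ ^ 3)⁻¹ * (δ ^ 3)⁻¹ := by field_simp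
        _ ≤ C ^ 3 * (a ^ 3)⁻¹ * (δ ^ 3)⁻¹ * 1 := by gcongr
        _ = _ := by ring
    linarith
  have hdiff : (v / a - v / b) ^ 2 * (d ^ 2)⁻¹ ≤ v ^ 2 * (a ^ 3)⁻¹ * (b ^ 3)⁻¹ := by
    have hab : 0 < a * b := by positivity
    have hne : a - b ≠ 0 := by
      rintro h; apply hd0; rw [hsub, sq_sub_sq, h, mul_zero]
    have e : (v / a - v / b) ^ 2 * (d ^ 2)⁻¹ = v ^ 2 * (a ^ 2 * b ^ 2 * (a + b) ^ 2)⁻¹ := by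
      rw [hsub, sq_sub_sq]
      field_simp
      ring
    rw [e, mul_assoc (v ^ 2), ← mul_inv]
    have hab2 : a * b ≤ (a + b) ^ 2 := by nlinarith [sq_nonneg a, sq_nonneg b]
    refine mul_le_mul_of_nonneg_left (inv_anti₀ (by positivity) ?_) (sq_nonneg v)
    calc a ^ 3 * b ^ 3 = a ^ 2 * b ^ 2 * (a * b) := by ring
      _ ≤ _ := by gcongr
  have hsq : (y - x) ^ 2 * (d ^ 2)⁻¹ ≤ 3 * (v ^ 2 * (a ^ 3)⁻¹ * (b ^ 3)⁻¹
      + (y - v / a) ^ 2 * (d ^ 2)⁻¹ + (x - v / b) ^ 2 * (d ^ 2)⁻¹) := by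
    have h3 : (y - x) ^ 2 ≤ 3 * ((v / a - v / b) ^ 2 + (y - v / a) ^ 2 + (x - v / b) ^ 2) := by
      nlinarith [sq_nonneg ((v / a - v / b) - (y - v / a)),
        sq_nonneg ((v / a - v / b) + (x - v / b)), sq_nonneg ((y - v / a) + (x - v / b))]
    have := mul_le_mul_of_nonneg_right h3 (by positivity : 0 ≤ (d ^ 2)⁻¹)
    linarith
  have hsq0 : 0 ≤ (y - x) ^ 2 * (d ^ 2)⁻¹ := by positivity
  have hid : (2 * x * y - x ^ 2) / (16 * d ^ 2)
      = y ^ 2 / 16 * (d ^ 2)⁻¹ - 1 / 16 * ((y - x) ^ 2 * (d ^ 2)⁻¹) := by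
    field_simp; ring
  rw [hid] at hT
  rw [abs_le] at hT ⊢
  constructor <;> linarith [hT.1, hT.2]

lemma sq_mul_inv_sq_le {A : ℝ} {e : ℕ → ℝ} (he : ∀ m : ℕ, |e m| ≤ A / √((m : ℝ) + 1))
    (n m : ℕ) :
    e m ^ 2 * ((((n : ℤ) - m : ℤ) : ℝ) ^ 2)⁻¹ ≤ 3 / 2 * A ^ 2 * (√((n : ℝ) + 1) ^ 2)⁻¹ *
      ((√((m : ℝ) + 1) ^ 3)⁻¹ + cubeKernel (n - m)) := by
  rcases eq_or_ne m n with rfl | hmn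
  · have := cubeKernel_nonneg ((m : ℤ) - m)
    simp only [sub_self, Int.cast_zero, ne_eq, OfNat.ofNat_ne_zero, not_false_eq_true,
      zero_pow, inv_zero, mul_zero] at this ⊢
    positivity
  have hd : 1 ≤ |(((n : ℤ) - m : ℤ) : ℝ)| := one_le_abs_intCast (by omega)
  have hκ := inv_sq_le_cubeKernel ((n : ℤ) - m)
  have hb1 := one_le_sqrt_succ m
  have hb2 := sqrt_succ_sq m
  have ha2 := sqrt_succ_sq n
  have hk : (n : ℝ) - m ≤ |(((n : ℤ) - m : ℤ) : ℝ)| := by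
    push_cast; exact le_abs_self _
  have hem : e m ^ 2 ≤ A ^ 2 * (√((m : ℝ) + 1) ^ 2)⁻¹ := by
    rw [← sq_abs, ← div_eq_mul_inv, ← div_pow]
    exact pow_le_pow_left₀ (abs_nonneg _) (he m) 2
  have hbb : ((√((m : ℝ) + 1) ^ 2) ^ 2)⁻¹ ≤ (√((m : ℝ) + 1) ^ 3)⁻¹ := by
    rw [← pow_mul]
    exact inv_anti₀ (by positivity) (pow_le_pow_right₀ hb1 (by norm_num))
  rw [← sq_abs (((n : ℤ) - m : ℤ) : ℝ)] at hκ ⊢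
  have hab : √((n : ℝ) + 1) ^ 2 ≤ √((m : ℝ) + 1) ^ 2 + |(((n : ℤ) - m : ℤ) : ℝ)| := by linarith
  have hapos : 0 < √((n : ℝ) + 1) ^ 2 := by positivity
  have hbpos : 1 ≤ √((m : ℝ) + 1) ^ 2 := one_le_pow₀ hb1
  generalize √((n : ℝ) + 1) ^ 2 = a at *
  generalize √((m : ℝ) + 1) ^ 2 = b at *
  generalize |(((n : ℤ) - m : ℤ) : ℝ)| = d at *
  have key : b⁻¹ * (d ^ 2)⁻¹ ≤ a⁻¹ * (3 / 2 * ((b ^ 2)⁻¹ + (d ^ 2)⁻¹)) := by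
    have hp : 0 < b⁻¹ := by positivity
    have hq : 0 < d⁻¹ := by positivity
    have e1 : b⁻¹ * (d ^ 2)⁻¹ = (b + d)⁻¹ * (b⁻¹ * d⁻¹ + (d⁻¹) ^ 2) := by
      field_simp
      ring
    have e2 : (b + d)⁻¹ ≤ a⁻¹ := inv_anti₀ hapos hab
    have e3 : b⁻¹ * d⁻¹ + (d⁻¹) ^ 2 ≤ 3 / 2 * ((b ^ 2)⁻¹ + (d ^ 2)⁻¹) := by
      rw [← inv_pow, ← inv_pow]
      nlinarith [sq_nonneg (b⁻¹ - d⁻¹), sq_nonneg b⁻¹]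
    rw [e1]
    exact mul_le_mul e2 e3 (by positivity) (by positivity)
  calc e m ^ 2 * (d ^ 2)⁻¹ ≤ A ^ 2 * b⁻¹ * (d ^ 2)⁻¹ := by gcongr
    _ = A ^ 2 * (b⁻¹ * (d ^ 2)⁻¹) := by ring
    _ ≤ A ^ 2 * (a⁻¹ * (3 / 2 * ((b ^ 2)⁻¹ + (d ^ 2)⁻¹))) := by gcongr
    _ = 3 / 2 * A ^ 2 * a⁻¹ * ((b ^ 2)⁻¹ + (d ^ 2)⁻¹) := by ring
    _ ≤ _ := by gcongr

lemma summable_cubeKernel_sub (n : ℕ) :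
    Summable (fun m : ℕ => cubeKernel (n - m)) ∧
    ∑' m : ℕ, cubeKernel (n - m) ≤ ∑' k, cubeKernel k :=
  ⟨summable_cubeKernel.comp_injective (injective_natCast_sub n),
    tsum_comp_le_tsum_of_inj summable_cubeKernel cubeKernel_nonneg (injective_natCast_sub n)⟩

/-- Convolving `e²` with the inverse square kernel. -/
lemma convolution_sq_bounds {A : ℝ} {e : ℕ → ℝ} (he : ∀ m : ℕ, |e m| ≤ A / √((m : ℝ) + 1))
    (hs : Summable fun m : ℕ => √((m : ℝ) + 1) * e m ^ 2) :
    (∀ n : ℕ, Summable fun m : ℕ => e m ^ 2 * ((((n : ℤ) - m : ℤ) : ℝ) ^ 2)⁻¹) ∧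
    (∀ n : ℕ, ∑' m : ℕ, e m ^ 2 * ((((n : ℤ) - m : ℤ) : ℝ) ^ 2)⁻¹
      ≤ 3 / 2 * A ^ 2 * (∑' m : ℕ, (√((m : ℝ) + 1) ^ 3)⁻¹ + ∑' k, cubeKernel k)
        * (√((n : ℝ) + 1) ^ 2)⁻¹) ∧
    Summable fun n : ℕ => √((n : ℝ) + 1) *
      ∑' m : ℕ, e m ^ 2 * ((((n : ℤ) - m : ℤ) : ℝ) ^ 2)⁻¹ := by
  have hb (n : ℕ) : Summable fun m : ℕ => 3 / 2 * A ^ 2 * (√((n : ℝ) + 1) ^ 2)⁻¹ *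
      ((√((m : ℝ) + 1) ^ 3)⁻¹ + cubeKernel (n - m)) :=
    (summable_inv_sqrt_succ_cube.add (summable_cubeKernel_sub n).1).mul_left _
  have h1 (n : ℕ) : Summable fun m : ℕ => e m ^ 2 * ((((n : ℤ) - m : ℤ) : ℝ) ^ 2)⁻¹ :=
    Summable.of_nonneg_of_le (fun m => by positivity) (sq_mul_inv_sq_le he n) (hb n)
  refine ⟨h1, fun n => ?_, ?_⟩
  · refine ((h1 n).tsum_le_tsum (sq_mul_inv_sq_le he n) (hb n)).trans ?_
    rw [tsum_mul_left, summable_inv_sqrt_succ_cube.tsum_add (summable_cubeKernel_sub n).1]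
    rw [mul_right_comm]
    gcongr
    exact (summable_cubeKernel_sub n).2
  · have hconv := summable_convolution (fun m => by positivity) cubeKernel_nonneg
      hs summable_cubeKernel
    refine Summable.of_nonneg_of_le (fun n => mul_nonneg (by positivity)
      (tsum_nonneg fun m => by positivity)) (fun n => ?_) (hconv.2.mul_left 2)
    rw [← tsum_mul_left, ← tsum_mul_left]
    refine ((h1 n).mul_left _).tsum_le_tsum (fun m => ?_) ((hconv.1 n).mul_left 2)
    rcases eq_or_ne m n with rfl | hmn
    · simp [cubeKernel]
    have hsn := sqrt_succ_le_two_mul hmn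
    have hd : 1 ≤ |(((n : ℤ) - m : ℤ) : ℝ)| := one_le_abs_intCast (by omega)
    have hδ := abs_intCast_eq_sq_sqrt ((n : ℤ) - m)
    have hδ1 : 1 ≤ √|(((n : ℤ) - m : ℤ) : ℝ)| := Real.one_le_sqrt.mpr hd
    rw [cubeKernel, ← sq_abs (((n : ℤ) - m : ℤ) : ℝ), hδ, Real.sqrt_sq (by positivity)]
    generalize √|(((n : ℤ) - m : ℤ) : ℝ)| = δ at *
    calc √((n : ℝ) + 1) * (e m ^ 2 * ((δ ^ 2) ^ 2)⁻¹)
        ≤ 2 * √((m : ℝ) + 1) * δ * (e m ^ 2 * ((δ ^ 2) ^ 2)⁻¹) := by gcongr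
      _ = _ := by field_simp

/-- Weighted square summability from a pointwise bound. -/
lemma summable_cube_mul_sq {s F e q : ℕ → ℝ} {a b c K : ℝ} (hs : ∀ n, 0 < s n)
    (hF : ∀ n, |F n| ≤ a * (s n ^ 3)⁻¹ + b * (|e n| * (s n)⁻¹) + c * q n)
    (hs3 : Summable fun n => (s n ^ 3)⁻¹) (he : Summable fun n => s n * e n ^ 2)
    (hq0 : ∀ n, 0 ≤ q n) (hq : ∀ n, q n ≤ K * (s n ^ 2)⁻¹) (hsq : Summable fun n => s n * q n) :
    Summable fun n => s n ^ 3 * F n ^ 2 := by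
  refine Summable.of_nonneg_of_le (fun n => mul_nonneg (pow_nonneg (hs n).le 3) (sq_nonneg _))
    (fun n => ?_) (((hs3.mul_left (3 * a ^ 2)).add (he.mul_left (3 * b ^ 2))).add
      (hsq.mul_left (3 * c ^ 2 * K)))
  have hsn := hs n
  have h1 : F n ^ 2 ≤ 3 * ((a * (s n ^ 3)⁻¹) ^ 2 + (b * (|e n| * (s n)⁻¹)) ^ 2 + (c * q n) ^ 2) := by
    rw [← sq_abs]
    refine (pow_le_pow_left₀ (abs_nonneg _) (hF n) 2).trans ?_
    generalize a * (s n ^ 3)⁻¹ = X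
    generalize b * (|e n| * (s n)⁻¹) = Y
    nlinarith [sq_nonneg (X - Y), sq_nonneg (X - c * q n), sq_nonneg (Y - c * q n)]
  have h2 : s n ^ 3 * q n ^ 2 ≤ K * (s n * q n) := by
    calc s n ^ 3 * q n ^ 2 = s n ^ 3 * q n * q n := by ring
      _ ≤ s n ^ 3 * q n * (K * (s n ^ 2)⁻¹) :=
        mul_le_mul_of_nonneg_left (hq n) (mul_nonneg (by positivity) (hq0 n))
      _ = _ := by field_simp
  calc s n ^ 3 * F n ^ 2
      ≤ s n ^ 3 * (3 * ((a * (s n ^ 3)⁻¹) ^ 2 + (b * (|e n| * (s n)⁻¹)) ^ 2 + (c * q n) ^ 2)) := by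
        gcongr
    _ = 3 * a ^ 2 * (s n ^ 3)⁻¹ + 3 * b ^ 2 * (s n * e n ^ 2)
        + 3 * c ^ 2 * (s n ^ 3 * q n ^ 2) := by
        rw [mul_pow b, mul_pow |e n|, sq_abs]; field_simp
    _ ≤ 3 * a ^ 2 * (s n ^ 3)⁻¹ + 3 * b ^ 2 * (s n * e n ^ 2)
        + 3 * c ^ 2 * (K * (s n * q n)) := by gcongr
    _ = _ := by ring

/-- For `μ` with `|μ_n| ≤ 1`, `|μ_n| ≤ C(n+1)^{-1/2}`, `μ_n - v(n+1)^{-1/2} ∈ ℓ²_{1/4}` and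
`4n + μ_n` strictly increasing: the arguments `1 - μ_m/(4(n-m)+μ_n)` are positive, the series
`R⁽²⁾_n = -Σ_{m≠n} (2 log(1 - μ_m/(4(n-m)+μ_n)) + μ_m/(2(n-m)))` converges absolutely, and
`R⁽²⁾_n + (π²v²/48)(n+1)⁻¹ ∈ ℓ²_{3/4}`. -/
theorem stmt14 (v : ℝ) (μ : ℕ → ℝ) (C : ℝ) (hC : 0 < C)
    (h1 : ∀ n : ℕ, |μ n| ≤ 1)
    (hbd : ∀ n : ℕ, |μ n| ≤ C * ((n : ℝ) + 1) ^ (-(1 : ℝ) / 2))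
    (hl2 : MemL2r (1 / 4) (fun n : ℕ => μ n - v * ((n : ℝ) + 1) ^ (-(1 : ℝ) / 2)))
    (hmono : StrictMono (fun n : ℕ => 4 * (n : ℝ) + μ n)) :
    (∀ n m : ℕ, m ≠ n → 0 < 1 - μ m / (4 * ((n : ℝ) - (m : ℝ)) + μ n)) ∧
    (∀ n : ℕ, Summable (fun m : ℕ => if m = n then (0 : ℝ) else
        |2 * Real.log (1 - μ m / (4 * ((n : ℝ) - (m : ℝ)) + μ n))
          + μ m / (2 * ((n : ℝ) - (m : ℝ)))|)) ∧
    MemL2r (3 / 4) (fun n : ℕ =>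
      (-∑' m : ℕ, if m = n then (0 : ℝ) else
          (2 * Real.log (1 - μ m / (4 * ((n : ℝ) - (m : ℝ)) + μ n))
            + μ m / (2 * ((n : ℝ) - (m : ℝ)))))
        + Real.pi ^ 2 * v ^ 2 / 48 * ((n : ℝ) + 1)⁻¹) := by
  have hrp (n : ℕ) : ((n : ℝ) + 1) ^ (-(1 : ℝ) / 2) = (√((n : ℝ) + 1))⁻¹ := by
    rw [neg_div, Real.rpow_neg (by positivity), ← Real.sqrt_eq_rpow]
  have hbd' (n : ℕ) : |μ n| ≤ C / √((n : ℝ) + 1) := by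
    rw [div_eq_mul_inv, ← hrp]; exact hbd n
  have hs0 (n : ℕ) : 0 < √((n : ℝ) + 1) := by positivity
  set e : ℕ → ℝ := fun n => μ n - v / √((n : ℝ) + 1) with he
  have hes : Summable fun n : ℕ => √((n : ℝ) + 1) * e n ^ 2 := by
    refine hl2.congr fun n => ?_
    simp only [he, hrp, div_eq_mul_inv v]
    rw [add_comm 1 (n : ℝ), show (2 : ℝ) * (1 / 4) = 1 / 2 by norm_num, ← Real.sqrt_eq_rpow]
  have hea (n : ℕ) : |e n| ≤ (C + |v|) / √((n : ℝ) + 1) := by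
    have h := abs_sub (μ n) (v / √((n : ℝ) + 1))
    rw [abs_div v, abs_of_pos (hs0 n)] at h
    rw [add_div]
    exact h.trans (by gcongr; exact hbd' n)
  obtain ⟨hq1, hq2, hq3⟩ := convolution_sq_bounds hea hes
  set K₁ := ∑' m : ℕ, (√((m : ℝ) + 1) ^ 3)⁻¹
  set K₂ := ∑' k, cubeKernel k
  set q : ℕ → ℝ := fun n => ∑' m : ℕ, e m ^ 2 * ((((n : ℤ) - m : ℤ) : ℝ) ^ 2)⁻¹
  set T : ℕ → ℕ → ℝ := fun n m => if m = n then (0 : ℝ) else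
    (2 * Real.log (1 - μ m / (4 * ((n : ℝ) - (m : ℝ)) + μ n))
      + μ m / (2 * ((n : ℝ) - (m : ℝ)))) with hT
  have hκ := summable_cubeKernel_sub
  have hι := abs_tsum_inv_sq_sub_le
  have hK₁0 : 0 ≤ K₁ := tsum_nonneg fun m => by positivity
  have hE (n : ℕ) := ((hκ n).1.mul_left (9 * C ^ 3 * (√((n : ℝ) + 1) ^ 3)⁻¹)).add
    ((((summable_inv_sqrt_succ_cube.mul_left (v ^ 2 * (√((n : ℝ) + 1) ^ 3)⁻¹)).add
      ((hι n).1.mul_left (e n ^ 2))).add (hq1 n)).mul_left (3 / 16))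
  have hTE (n m : ℕ) := abs_term_sub_le (v := v) hC h1 hbd' n m
  have hD (n : ℕ) : Summable fun m => T n m - μ n ^ 2 / 16 * ((((n : ℤ) - m : ℤ) : ℝ) ^ 2)⁻¹ :=
    Summable.of_norm_bounded (hE n) (hTE n)
  have hTs (n : ℕ) : Summable (T n) :=
    ((hD n).add ((hι n).1.mul_left (μ n ^ 2 / 16))).congr fun m => sub_add_cancel _ _
  have hS (n : ℕ) : ∑' m : ℕ, ((((n : ℤ) - m : ℤ) : ℝ) ^ 2)⁻¹ ≤ K₂ :=
    ((hι n).1.tsum_le_tsum (fun m => inv_sq_le_cubeKernel _) (hκ n).1).trans (hκ n).2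
  have hsum (n : ℕ) : |∑' m, T n m - μ n ^ 2 / 16 * ∑' m : ℕ, ((((n : ℤ) - m : ℤ) : ℝ) ^ 2)⁻¹|
      ≤ 9 * C ^ 3 * (√((n : ℝ) + 1) ^ 3)⁻¹ * K₂ + 3 / 16 *
        (v ^ 2 * (√((n : ℝ) + 1) ^ 3)⁻¹ * K₁ + e n ^ 2 * K₂ + q n) := by
    rw [← tsum_mul_left, ← (hTs n).tsum_sub ((hι n).1.mul_left _)]
    refine (tsum_of_norm_bounded
      (f := fun m => T n m - μ n ^ 2 / 16 * ((((n : ℤ) - m : ℤ) : ℝ) ^ 2)⁻¹) (hE n).hasSum (hTE n)).trans ?_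
    rw [((hκ n).1.mul_left _).tsum_add ((((summable_inv_sqrt_succ_cube.mul_left _).add
        ((hι n).1.mul_left _)).add (hq1 n)).mul_left _), tsum_mul_left, tsum_mul_left,
      ((summable_inv_sqrt_succ_cube.mul_left _).add ((hι n).1.mul_left _)).tsum_add (hq1 n),
      (summable_inv_sqrt_succ_cube.mul_left _).tsum_add ((hι n).1.mul_left _),
      tsum_mul_left, tsum_mul_left]
    have := (hκ n).2
    have := hS n
    gcongr
  refine ⟨fun n m hmn => ?_, fun n => ?_, ?_⟩
  · have hd := one_le_abs_intCast (k := (n : ℤ) - m) (by omega)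
    push_cast at hd
    exact (abs_two_mul_log_sub_le (h1 m) (h1 n) hd).1
  · refine (hTs n).abs.congr fun m => ?_
    by_cases h : m = n <;> simp [hT, h]
  · have hfin := summable_cube_mul_sq (s := fun n : ℕ => √((n : ℝ) + 1))
      (F := fun n => (-∑' m, T n m) + Real.pi ^ 2 * v ^ 2 / 48 * ((n : ℝ) + 1)⁻¹)
      (e := e) (q := q)
      (a := 9 * C ^ 3 * K₂ + 3 / 16 * v ^ 2 * K₁ + C ^ 2 / 16 * K₁)
      (b := 3 / 16 * K₂ * (C + |v|) + Real.pi ^ 2 / 48 * (C + |v|)) (c := 3 / 16)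
      (K := 3 / 2 * (C + |v|) ^ 2 * (K₁ + K₂)) hs0 (fun n => ?_) summable_inv_sqrt_succ_cube hes
      (fun n => tsum_nonneg fun m => by positivity) hq2 hq3
    · refine hfin.congr fun n => ?_
      congr 1
      rw [Real.sqrt_eq_rpow, ← Real.rpow_natCast, ← Real.rpow_mul (by positivity),
        add_comm 1 (n : ℝ)]
      norm_num
    have hsn := hsum n
    have hSn := (hι n).2
    have hen := hea n
    have hμn := hbd' n
    have hK₂0 : 0 ≤ K₂ := tsum_nonneg cubeKernel_nonneg
    have hμe : μ n = e n + v * (√((n : ℝ) + 1))⁻¹ := by rw [he]; ring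
    rw [show ((n : ℝ) + 1)⁻¹ = (√((n : ℝ) + 1))⁻¹ ^ 2 by rw [inv_pow, sqrt_succ_sq]]
    have hsp := hs0 n
    rw [div_eq_mul_inv] at hen hμn
    rw [← inv_pow] at hsn ⊢
    have hr : 0 < (√((n : ℝ) + 1))⁻¹ := by positivity
    generalize (√((n : ℝ) + 1))⁻¹ = r at *
    generalize ∑' m : ℕ, ((((n : ℤ) - m : ℤ) : ℝ) ^ 2)⁻¹ = S at *
    generalize ∑' m, T n m = R at *
    generalize q n = Q at *
    generalize μ n = y at *
    have hCv : 0 ≤ C + |v| := by positivity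
    have he2 : e n ^ 2 * K₂ ≤ K₂ * (C + |v|) * (|e n| * r) := by
      rw [← sq_abs]
      calc |e n| ^ 2 * K₂ = K₂ * |e n| * |e n| := by ring
        _ ≤ K₂ * |e n| * ((C + |v|) * r) := by gcongr
        _ = _ := by ring
    have hy2 : |y ^ 2 / 16 * (S - Real.pi ^ 2 / 3)| ≤ C ^ 2 / 16 * K₁ * r ^ 3 := by
      rw [abs_mul, abs_div, abs_pow, abs_of_pos (by norm_num : (0 : ℝ) < 16)]
      calc |y| ^ 2 / 16 * |S - Real.pi ^ 2 / 3| ≤ (C * r) ^ 2 / 16 * (r * K₁) := by gcongr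
        _ = _ := by ring
    have hyv : |Real.pi ^ 2 / 48 * (y ^ 2 - v ^ 2 * r ^ 2)|
        ≤ Real.pi ^ 2 / 48 * (C + |v|) * (|e n| * r) := by
      have h : y ^ 2 - v ^ 2 * r ^ 2 = e n * (y + v * r) := by
        rw [show e n = y - v * r by rw [hμe]; ring]; ring
      have h' : |y + v * r| ≤ (C + |v|) * r := by
        refine (abs_add_le _ _).trans ?_
        rw [abs_mul, abs_of_pos hr, add_mul]
        gcongr
      rw [h, abs_mul, abs_mul, abs_of_nonneg (by positivity : 0 ≤ Real.pi ^ 2 / 48)]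
      calc Real.pi ^ 2 / 48 * (|e n| * |y + v * r|)
          ≤ Real.pi ^ 2 / 48 * (|e n| * ((C + |v|) * r)) := by gcongr
        _ = _ := by ring
    rw [abs_le] at hsn hy2 hyv ⊢
    constructor <;> linarith [hsn.1, hsn.2, hy2.1, hy2.2, hyv.1, hyv.2]
end
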